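/- The logic CK has the uniform interpolation property: for every formula φ and every propositional variable p there exist formulas ∃pφ and ∀pφ such that (1) vars(∃pφ) ⊆ vars(φ)\{p} and vars(∀pφ) ⊆ vars(φ)\{p}; (2) ⊢_CK φ → ∃pφ and ⊢_CK ∀pφ → φ; and (3) for every formula ψ with p ∉ vars(ψ): if ⊢_CK φ → ψ then ⊢_CK ∃pφ → ψ, and if ⊢_CK ψ → φ then ⊢_CK ψ → ∀pφ. -/

import Mathlib

/-- Formulas of the modal language: φ ::= p | ⊥ | φ∧φ | φ∨φ | φ→φ | □φ | ◇φ. -/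
inductive Form : Type
  | var : ℕ → Form
  | bot : Form
  | and : Form → Form → Form
  | or  : Form → Form → Form
  | imp : Form → Form → Form
  | box : Form → Form
  | dia : Form → Form
  deriving DecidableEq

/-- Helper for □⁻¹: remove an outer box. -/
def unboxF : Form → Option Form
  | Form.box φ => some φ
  | _ => none

/-- □⁻¹Γ := {φ | □φ ∈ Γ}, as a multiset operation. -/
def boxInv (Γ : Multiset Form) : Multiset Form := Γ.filterMap unboxF

/-- ◇⁻¹Δ for a succedent Δ with at most one formula (modelled by `Option`). -/
def diaInv : Option Form → Option Form
  | some (Form.dia φ) => some φ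
  | _ => none

/-- Provability in the sequent calculus G4CK: sequents Γ ⇒ δ with a
multiset antecedent and a single-formula succedent. -/
inductive G4CK : Multiset Form → Form → Prop
  | botL (Γ δ) : G4CK (Form.bot ::ₘ Γ) δ
  | idP (Γ n) : G4CK (Form.var n ::ₘ Γ) (Form.var n)
  | andL (Γ φ ψ δ) : G4CK (φ ::ₘ ψ ::ₘ Γ) δ → G4CK (Form.and φ ψ ::ₘ Γ) δ
  | andR (Γ φ ψ) : G4CK Γ φ → G4CK Γ ψ → G4CK Γ (Form.and φ ψ)
  | orL (Γ φ ψ δ) : G4CK (φ ::ₘ Γ) δ → G4CK (ψ ::ₘ Γ) δ → G4CK (Form.or φ ψ ::ₘ Γ) δ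
  | orR1 (Γ φ ψ) : G4CK Γ φ → G4CK Γ (Form.or φ ψ)
  | orR2 (Γ φ ψ) : G4CK Γ ψ → G4CK Γ (Form.or φ ψ)
  | impR (Γ φ ψ) : G4CK (φ ::ₘ Γ) ψ → G4CK Γ (Form.imp φ ψ)
  | andImpL (Γ φ ψ χ δ) :
      G4CK (Form.imp φ (Form.imp ψ χ) ::ₘ Γ) δ →
      G4CK (Form.imp (Form.and φ ψ) χ ::ₘ Γ) δ
  | orImpL (Γ φ ψ χ δ) :
      G4CK (Form.imp φ χ ::ₘ Form.imp ψ χ ::ₘ Γ) δ →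
      G4CK (Form.imp (Form.or φ ψ) χ ::ₘ Γ) δ
  | pImpL (Γ n φ δ) :
      G4CK (Form.var n ::ₘ φ ::ₘ Γ) δ →
      G4CK (Form.var n ::ₘ Form.imp (Form.var n) φ ::ₘ Γ) δ
  | impImpL (Γ φ ψ χ δ) :
      G4CK (Form.imp ψ χ ::ₘ Γ) (Form.imp φ ψ) → G4CK (χ ::ₘ Γ) δ →
      G4CK (Form.imp (Form.imp φ ψ) χ ::ₘ Γ) δ
  | boxR (Γ φ) : G4CK (boxInv Γ) φ → G4CK Γ (Form.box φ)
  | boxImpL (Γ φ ψ δ) :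
      G4CK (boxInv Γ) φ → G4CK (ψ ::ₘ Γ) δ →
      G4CK (Form.imp (Form.box φ) ψ ::ₘ Γ) δ
  | diaImpL (Γ γ φ ψ δ) :
      G4CK (γ ::ₘ boxInv Γ) φ → G4CK (ψ ::ₘ Form.dia γ ::ₘ Γ) δ →
      G4CK (Form.imp (Form.dia φ) ψ ::ₘ Form.dia γ ::ₘ Γ) δ
  | diaL (Γ φ ψ) : G4CK (φ ::ₘ boxInv Γ) ψ → G4CK (Form.dia φ ::ₘ Γ) (Form.dia ψ)

/-- Provability in the sequent calculus G4WK: sequents Γ ⇒ Δ with a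
multiset antecedent and a succedent with at most one formula (`Option Form`). -/
inductive G4WK : Multiset Form → Option Form → Prop
  | botL (Γ Δ) : G4WK (Form.bot ::ₘ Γ) Δ
  | idP (Γ n) : G4WK (Form.var n ::ₘ Γ) (some (Form.var n))
  | andL (Γ φ ψ Δ) : G4WK (φ ::ₘ ψ ::ₘ Γ) Δ → G4WK (Form.and φ ψ ::ₘ Γ) Δ
  | andR (Γ φ ψ) : G4WK Γ (some φ) → G4WK Γ (some ψ) → G4WK Γ (some (Form.and φ ψ))
  | orL (Γ φ ψ Δ) : G4WK (φ ::ₘ Γ) Δ → G4WK (ψ ::ₘ Γ) Δ → G4WK (Form.or φ ψ ::ₘ Γ) Δ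
  | orR1 (Γ φ ψ) : G4WK Γ (some φ) → G4WK Γ (some (Form.or φ ψ))
  | orR2 (Γ φ ψ) : G4WK Γ (some ψ) → G4WK Γ (some (Form.or φ ψ))
  | impR (Γ φ ψ) : G4WK (φ ::ₘ Γ) (some ψ) → G4WK Γ (some (Form.imp φ ψ))
  | andImpL (Γ φ ψ χ Δ) :
      G4WK (Form.imp φ (Form.imp ψ χ) ::ₘ Γ) Δ →
      G4WK (Form.imp (Form.and φ ψ) χ ::ₘ Γ) Δ
  | orImpL (Γ φ ψ χ Δ) :
      G4WK (Form.imp φ χ ::ₘ Form.imp ψ χ ::ₘ Γ) Δ →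
      G4WK (Form.imp (Form.or φ ψ) χ ::ₘ Γ) Δ
  | pImpL (Γ n φ Δ) :
      G4WK (Form.var n ::ₘ φ ::ₘ Γ) Δ →
      G4WK (Form.var n ::ₘ Form.imp (Form.var n) φ ::ₘ Γ) Δ
  | impImpL (Γ φ ψ χ Δ) :
      G4WK (Form.imp ψ χ ::ₘ Γ) (some (Form.imp φ ψ)) → G4WK (χ ::ₘ Γ) Δ →
      G4WK (Form.imp (Form.imp φ ψ) χ ::ₘ Γ) Δ
  | boxR (Γ φ) : G4WK (boxInv Γ) (some φ) → G4WK Γ (some (Form.box φ))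
  | boxImpL (Γ φ ψ Δ) :
      G4WK (boxInv Γ) (some φ) → G4WK (ψ ::ₘ Γ) Δ →
      G4WK (Form.imp (Form.box φ) ψ ::ₘ Γ) Δ
  | diaImpL (Γ γ φ ψ Δ) :
      G4WK (γ ::ₘ boxInv Γ) (some φ) → G4WK (ψ ::ₘ Form.dia γ ::ₘ Γ) Δ →
      G4WK (Form.imp (Form.dia φ) ψ ::ₘ Form.dia γ ::ₘ Γ) Δ
  | diaL' (Γ φ Δ) : G4WK (φ ::ₘ boxInv Γ) (diaInv Δ) → G4WK (Form.dia φ ::ₘ Γ) Δ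

/-- Axiom schemes of the generalised Hilbert calculus CKH:
intuitionistic axioms A1–A9 together with K_□ and K_◇. -/
inductive CKAx : Form → Prop
  | a1 (φ ψ : Form) : CKAx (φ.imp (ψ.imp φ))
  | a2 (φ ψ χ : Form) : CKAx ((φ.imp (ψ.imp χ)).imp ((φ.imp ψ).imp (φ.imp χ)))
  | a3 (φ ψ : Form) : CKAx (φ.imp (φ.or ψ))
  | a4 (φ ψ : Form) : CKAx (ψ.imp (φ.or ψ))
  | a5 (φ ψ χ : Form) : CKAx ((φ.imp χ).imp ((ψ.imp χ).imp ((φ.or ψ).imp χ)))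
  | a6 (φ ψ : Form) : CKAx ((φ.and ψ).imp φ)
  | a7 (φ ψ : Form) : CKAx ((φ.and ψ).imp ψ)
  | a8 (φ ψ χ : Form) : CKAx ((φ.imp ψ).imp ((φ.imp χ).imp (φ.imp (ψ.and χ))))
  | a9 (φ : Form) : CKAx (Form.bot.imp φ)
  | kbox (φ ψ : Form) : CKAx ((φ.imp ψ).box.imp (φ.box.imp ψ.box))
  | kdia (φ ψ : Form) : CKAx ((φ.imp ψ).box.imp (φ.dia.imp ψ.dia))

/-- Axiom schemes of WKH: those of CKH together with N : ¬◇⊥. -/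
inductive WKAx : Form → Prop
  | ck {φ : Form} : CKAx φ → WKAx φ
  | n : WKAx (Form.bot.dia.imp Form.bot)

/-- Derivability Γ ⊢ φ in the generalised Hilbert calculus CKH. -/
inductive CKH : Set Form → Form → Prop
  | ax {Γ : Set Form} {φ : Form} : CKAx φ → CKH Γ φ
  | el {Γ : Set Form} {φ : Form} : φ ∈ Γ → CKH Γ φ
  | mp {Γ : Set Form} {φ ψ : Form} : CKH Γ φ → CKH Γ (φ.imp ψ) → CKH Γ ψ
  | nec {Γ : Set Form} {φ : Form} : CKH ∅ φ → CKH Γ φ.box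

/-- Derivability Γ ⊢ φ in the generalised Hilbert calculus WKH. -/
inductive WKH : Set Form → Form → Prop
  | ax {Γ : Set Form} {φ : Form} : WKAx φ → WKH Γ φ
  | el {Γ : Set Form} {φ : Form} : φ ∈ Γ → WKH Γ φ
  | mp {Γ : Set Form} {φ ψ : Form} : WKH Γ φ → WKH Γ (φ.imp ψ) → WKH Γ ψ
  | nec {Γ : Set Form} {φ : Form} : WKH ∅ φ → WKH Γ φ.box

/-- The set of propositional variables occurring in a formula. -/
def vars : Form → Set ℕ
  | .var n => {n}
  | .bot => ∅
  | .and φ ψ => vars φ ∪ vars ψ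
  | .or φ ψ => vars φ ∪ vars ψ
  | .imp φ ψ => vars φ ∪ vars ψ
  | .box φ => vars φ
  | .dia φ => vars φ

/-- Variables occurring in a multiset of formulas. -/
def varsM (Γ : Multiset Form) : Set ℕ := {n | ∃ φ ∈ Γ, n ∈ vars φ}

/-- Variables occurring in a succedent with at most one formula. -/
def varsO : Option Form → Set ℕ
  | none => ∅
  | some φ => vars φ

namespace CKH

theorem mono {Γ Δ : Set Form} {φ : Form} (h : CKH Γ φ) (hs : Γ ⊆ Δ) : CKH Δ φ := by
  induction h generalizing Δ with
  | ax h => exact .ax h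
  | el h => exact .el (hs h)
  | mp _ _ ih₁ ih₂ => exact .mp (ih₁ hs) (ih₂ hs)
  | nec h _ => exact .nec h

theorem cut {Γ Δ : Set Form} {φ : Form} (h : CKH Δ φ) (hs : ∀ ψ ∈ Δ, CKH Γ ψ) : CKH Γ φ := by
  induction h generalizing Γ with
  | ax h => exact .ax h
  | el h => exact hs _ h
  | mp _ _ ih₁ ih₂ => exact .mp (ih₁ hs) (ih₂ hs)
  | nec h _ => exact .nec h

theorem weaken_imp {Γ : Set Form} {φ ψ : Form} (h : CKH Γ ψ) : CKH Γ (φ.imp ψ) :=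
  .mp h (.ax (.a1 _ _))

theorem imp_self {Γ : Set Form} (φ : Form) : CKH Γ (φ.imp φ) :=
  .mp (.ax (.a1 φ φ)) (.mp (.ax (.a1 φ (φ.imp φ))) (.ax (.a2 _ _ _)))

theorem deduction {Γ : Set Form} {φ ψ : Form} (h : CKH (insert φ Γ) ψ) : CKH Γ (φ.imp ψ) := by
  generalize hΔ : insert φ Γ = Δ at h
  induction h with
  | ax h => exact weaken_imp (.ax h)
  | el h =>
    subst hΔ
    rcases h with rfl | h
    · exact imp_self _
    · exact weaken_imp (.el h)
  | mp _ _ ih₁ ih₂ => exact .mp (ih₁ hΔ) (.mp (ih₂ hΔ) (.ax (.a2 _ _ _)))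
  | nec h _ => exact weaken_imp (.nec h)

theorem and_intro {Γ : Set Form} {φ ψ : Form} (h₁ : CKH Γ φ) (h₂ : CKH Γ ψ) :
    CKH Γ (φ.and ψ) :=
  .mp (imp_self Form.bot) (.mp (weaken_imp h₂) (.mp (weaken_imp h₁) (.ax (.a8 _ _ _))))

theorem or_elim {Γ : Set Form} {φ ψ χ : Form} (h : CKH Γ (φ.or ψ))
    (h₁ : CKH (insert φ Γ) χ) (h₂ : CKH (insert ψ Γ) χ) : CKH Γ χ :=
  .mp h (.mp h₂.deduction (.mp h₁.deduction (.ax (.a5 _ _ _))))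

theorem box_of {Γ Δ : Set Form} {φ : Form} (h : CKH Δ φ) (hs : ∀ ψ ∈ Δ, ψ.box ∈ Γ) :
    CKH Γ φ.box := by
  induction h generalizing Γ with
  | ax h => exact .nec (.ax h)
  | el h => exact .el (hs _ h)
  | mp _ _ ih₁ ih₂ => exact .mp (ih₁ hs) (.mp (ih₂ hs) (.ax (.kbox _ _)))
  | nec h _ => exact .nec (.nec h)

theorem dia_of {Γ Δ : Set Form} {γ φ : Form} (h : CKH (insert γ Δ) φ)
    (hs : ∀ ψ ∈ Δ, ψ.box ∈ Γ) (hγ : γ.dia ∈ Γ) : CKH Γ φ.dia :=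
  .mp (.el hγ) (.mp (box_of h.deduction hs) (.ax (.kdia _ _)))

end CKH

/-- A birelational model of `CK` with a set `F` of fallible worlds, at which every formula holds. -/
structure CKModel where
  W : Type
  le : W → W → Prop
  R : W → W → Prop
  F : W → Prop
  V : W → ℕ → Prop
  le_refl : ∀ w, le w w
  le_trans : ∀ {w v u}, le w v → le v u → le w u
  F_le : ∀ {w v}, le w v → F w → F v
  F_R : ∀ {w v}, R w v → F w → F v
  F_serial : ∀ {w}, F w → ∃ v, R w v ∧ F v
  V_le : ∀ {w v n}, le w v → V w n → V v n
  V_F : ∀ {w n}, F w → V w n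

/-- Truth of a formula at a world. -/
def CKModel.force (M : CKModel) : Form → M.W → Prop
  | .var n, w => M.V w n
  | .bot, w => M.F w
  | .and φ ψ, w => M.force φ w ∧ M.force ψ w
  | .or φ ψ, w => M.force φ w ∨ M.force ψ w
  | .imp φ ψ, w => ∀ v, M.le w v → M.force φ v → M.force ψ v
  | .box φ, w => ∀ v, M.le w v → ∀ u, M.R v u → M.force φ u
  | .dia φ, w => ∀ v, M.le w v → ∃ u, M.R v u ∧ M.force φ u

/-- Truth of all formulas of a context at a world. -/
def CKModel.forces (M : CKModel) (Γ : Multiset Form) (w : M.W) : Prop :=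
  ∀ φ ∈ Γ, M.force φ w

/-- Semantic entailment. -/
def Ent (Γ : Multiset Form) (δ : Form) : Prop :=
  ∀ (M : CKModel) (w : M.W), M.forces Γ w → M.force δ w

namespace CKModel

variable {M : CKModel}

theorem force_le {φ : Form} {w v : M.W} (h : M.le w v) (hw : M.force φ w) : M.force φ v := by
  induction φ generalizing w v with
  | var n => exact M.V_le h hw
  | bot => exact M.F_le h hw
  | and φ ψ ih₁ ih₂ => exact ⟨ih₁ h hw.1, ih₂ h hw.2⟩
  | or φ ψ ih₁ ih₂ => exact hw.imp (ih₁ h) (ih₂ h)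
  | imp φ ψ _ _ => exact fun u hu => hw u (M.le_trans h hu)
  | box φ _ => exact fun u hu => hw u (M.le_trans h hu)
  | dia φ _ => exact fun u hu => hw u (M.le_trans h hu)

theorem force_of_F {φ : Form} {w : M.W} (h : M.F w) : M.force φ w := by
  induction φ generalizing w with
  | var n => exact M.V_F h
  | bot => exact h
  | and φ ψ ih₁ ih₂ => exact ⟨ih₁ h, ih₂ h⟩
  | or φ ψ ih₁ _ => exact .inl (ih₁ h)
  | imp φ ψ _ ih₂ => exact fun v hv _ => ih₂ (M.F_le hv h)
  | box φ ih => exact fun v hv u hu => ih (M.F_R hu (M.F_le hv h))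
  | dia φ ih =>
    intro v hv
    obtain ⟨u, hu, hF⟩ := M.F_serial (M.F_le hv h)
    exact ⟨u, hu, ih hF⟩

theorem forces_le {Γ : Multiset Form} {w v : M.W} (h : M.le w v) (hw : M.forces Γ w) :
    M.forces Γ v :=
  fun φ hφ => force_le h (hw φ hφ)

@[simp] theorem forces_cons {φ : Form} {Γ : Multiset Form} {w : M.W} :
    M.forces (φ ::ₘ Γ) w ↔ M.force φ w ∧ M.forces Γ w := by
  simp [forces]

@[simp] theorem forces_add {Γ Δ : Multiset Form} {w : M.W} :
    M.forces (Γ + Δ) w ↔ M.forces Γ w ∧ M.forces Δ w := by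
  simp only [forces, Multiset.mem_add]
  exact ⟨fun h => ⟨fun φ hφ => h φ (.inl hφ), fun φ hφ => h φ (.inr hφ)⟩,
    fun h φ hφ => hφ.elim (h.1 φ) (h.2 φ)⟩

theorem force_ax {φ : Form} (h : CKAx φ) (w : M.W) : M.force φ w := by
  cases h with
  | a1 φ ψ => exact fun v _ hv u hu _ => force_le hu hv
  | a2 φ ψ χ =>
    exact fun v _ hv u hu hu' t ht ht' =>
      hv t (M.le_trans hu ht) ht' t (M.le_refl _) (hu' t ht ht')
  | a3 φ ψ => exact fun v _ hv => .inl hv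
  | a4 φ ψ => exact fun v _ hv => .inr hv
  | a5 φ ψ χ =>
    exact fun v _ hv u hu hu' t ht ht' =>
      ht'.elim (hv t (M.le_trans hu ht)) (hu' t ht)
  | a6 φ ψ => exact fun v _ hv => hv.1
  | a7 φ ψ => exact fun v _ hv => hv.2
  | a8 φ ψ χ =>
    exact fun v _ hv u hu hu' t ht ht' => ⟨hv t (M.le_trans hu ht) ht', hu' t ht ht'⟩
  | a9 φ => exact fun v _ hv => force_of_F hv
  | kbox φ ψ =>
    exact fun v _ hv u hu hu' t ht s hs =>
      hv t (M.le_trans hu ht) s hs s (M.le_refl _) (hu' t ht s hs)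
  | kdia φ ψ =>
    intro v _ hv u hu hu' t ht
    obtain ⟨s, hs, hs'⟩ := hu' t ht
    exact ⟨s, hs, hv t (M.le_trans hu ht) s hs s (M.le_refl _) hs'⟩

theorem force_of_CKH {Γ : Set Form} {φ : Form} (h : CKH Γ φ) (w : M.W)
    (hw : ∀ ψ ∈ Γ, M.force ψ w) : M.force φ w := by
  induction h generalizing w with
  | ax h => exact force_ax h w
  | el h => exact hw _ h
  | mp _ _ ih₁ ih₂ => exact ih₂ w hw w (M.le_refl _) (ih₁ w hw)
  | nec _ ih => exact fun _ _ u _ => ih u (by simp)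

end CKModel

theorem mem_boxInv {Γ : Multiset Form} {φ : Form} : φ ∈ boxInv Γ ↔ φ.box ∈ Γ := by
  unfold boxInv
  rw [Multiset.mem_filterMap]
  constructor
  · rintro ⟨a, ha, h⟩
    cases a <;> simp_all [unboxF]
  · exact fun h => ⟨_, h, rfl⟩

theorem boxInv_add (Γ Δ : Multiset Form) : boxInv (Γ + Δ) = boxInv Γ + boxInv Δ := by
  simp [boxInv]

theorem CKModel.forces_boxInv {M : CKModel} {Γ : Multiset Form} {w v u : M.W}
    (hw : M.forces Γ w) (hv : M.le w v) (hu : M.R v u) : M.forces (boxInv Γ) u :=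
  fun _ hφ => hw _ (mem_boxInv.1 hφ) v hv u hu

/-- The reasons for which a formula can hold at a world added below all models of a context. -/
def Dir (Γ : Multiset Form) : Form → Prop
  | .var n => .var n ∈ Γ
  | .bot => False
  | .and φ ψ => Ent Γ φ ∧ Ent Γ ψ
  | .or φ ψ => Ent Γ φ ∨ Ent Γ ψ
  | .imp φ ψ => Ent Γ (φ.imp ψ)
  | .box φ => Ent (boxInv Γ) φ
  | .dia φ => ∃ γ, Form.dia γ ∈ Γ ∧ Ent (γ ::ₘ boxInv Γ) φ

theorem Dir.ent {Γ : Multiset Form} {α : Form} (h : Dir Γ α) : Ent Γ α := by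
  intro M w hw
  cases α with
  | var n => exact hw _ h
  | bot => exact h.elim
  | and φ ψ => exact ⟨h.1 M w hw, h.2 M w hw⟩
  | or φ ψ => exact h.imp (fun h => h M w hw) (fun h => h M w hw)
  | imp φ ψ => exact h M w hw
  | box φ => exact fun v hv u hu => h M u (CKModel.forces_boxInv hw hv hu)
  | dia φ =>
    obtain ⟨γ, hγ, h⟩ := h
    intro v hv
    obtain ⟨u, hu, hγu⟩ := hw _ hγ v hv
    exact ⟨u, hu, h M u (by simp [hγu, CKModel.forces_boxInv hw hv hu])⟩

/-- A sum of countermodels to all refutable sequents, together with a fallible world. -/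
theorem exists_universal_model : ∃ U : CKModel, (∃ u, U.F u) ∧
    ∀ Γ δ, ¬ Ent Γ δ → ∃ w, U.forces Γ w ∧ ¬ U.force δ w := by
  let S := {s : Multiset Form × Form // ¬ Ent s.1 s.2}
  have hS : ∀ s : S, ∃ (M : CKModel) (w : M.W), M.forces s.1.1 w ∧ ¬ M.force s.1.2 w := by
    intro s
    simpa [Ent] using s.2
  choose N w hN using hS
  let U : CKModel :=
    { W := Option (Σ s, (N s).W)
      le := fun a b => match a, b with
        | none, none => True
        | some ⟨s, x⟩, some ⟨t, y⟩ => ∃ h : s = t, (N t).le (h ▸ x) y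
        | _, _ => False
      R := fun a b => match a, b with
        | none, none => True
        | some ⟨s, x⟩, some ⟨t, y⟩ => ∃ h : s = t, (N t).R (h ▸ x) y
        | _, _ => False
      F := fun a => match a with
        | none => True
        | some ⟨s, x⟩ => (N s).F x
      V := fun a n => match a with
        | none => True
        | some ⟨s, x⟩ => (N s).V x n
      le_refl := by
        rintro (_ | ⟨s, x⟩)
        · trivial
        · exact ⟨rfl, (N s).le_refl x⟩
      le_trans := by
        rintro (_ | ⟨s, x⟩) (_ | ⟨t, y⟩) (_ | ⟨r, z⟩) h h' <;> try trivial
        obtain ⟨rfl, h⟩ := h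
        obtain ⟨rfl, h'⟩ := h'
        exact ⟨rfl, (N _).le_trans h h'⟩
      F_le := by
        rintro (_ | ⟨s, x⟩) (_ | ⟨t, y⟩) h h' <;> try trivial
        obtain ⟨rfl, h⟩ := h
        exact (N _).F_le h h'
      F_R := by
        rintro (_ | ⟨s, x⟩) (_ | ⟨t, y⟩) h h' <;> try trivial
        obtain ⟨rfl, h⟩ := h
        exact (N _).F_R h h'
      F_serial := by
        rintro (_ | ⟨s, x⟩) h
        · exact ⟨none, trivial, trivial⟩
        · obtain ⟨v, hv, hF⟩ := (N s).F_serial h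
          exact ⟨some ⟨s, v⟩, ⟨rfl, hv⟩, hF⟩
      V_le := by
        rintro (_ | ⟨s, x⟩) (_ | ⟨t, y⟩) n h h' <;> try trivial
        obtain ⟨rfl, h⟩ := h
        exact (N _).V_le h h'
      V_F := by
        rintro (_ | ⟨s, x⟩) n h
        · trivial
        · exact (N s).V_F h }
  have key : ∀ φ s (x : (N s).W), U.force φ (some ⟨s, x⟩) ↔ (N s).force φ x := by
    intro φ
    induction φ with
    | var n => exact fun _ _ => Iff.rfl
    | bot => exact fun _ _ => Iff.rfl
    | and φ ψ ih₁ ih₂ => exact fun s x => and_congr (ih₁ s x) (ih₂ s x)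
    | or φ ψ ih₁ ih₂ => exact fun s x => or_congr (ih₁ s x) (ih₂ s x)
    | imp φ ψ ih₁ ih₂ =>
      intro s x
      constructor
      · intro h y hy hφ
        exact (ih₂ s y).1 (h (some ⟨s, y⟩) ⟨rfl, hy⟩ ((ih₁ s y).2 hφ))
      · rintro h (_ | ⟨t, y⟩) hy hφ
        · exact hy.elim
        · obtain ⟨rfl, hy⟩ := hy
          exact (ih₂ _ y).2 (h y hy ((ih₁ _ y).1 hφ))
    | box φ ih =>
      intro s x
      constructor
      · intro h y hy z hz
        exact (ih s z).1 (h (some ⟨s, y⟩) ⟨rfl, hy⟩ (some ⟨s, z⟩) ⟨rfl, hz⟩)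
      · rintro h (_ | ⟨t, y⟩) hy (_ | ⟨r, z⟩) hz
        · exact hy.elim
        · exact hy.elim
        · exact hz.elim
        · obtain ⟨rfl, hy⟩ := hy
          obtain ⟨rfl, hz⟩ := hz
          exact (ih _ z).2 (h y hy z hz)
    | dia φ ih =>
      intro s x
      constructor
      · intro h y hy
        obtain ⟨_ | ⟨r, z⟩, hz, hφ⟩ := h (some ⟨s, y⟩) ⟨rfl, hy⟩
        · exact hz.elim
        · obtain ⟨rfl, hz⟩ := hz
          exact ⟨z, hz, (ih _ z).1 hφ⟩
      · rintro h (_ | ⟨t, y⟩) hy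
        · exact hy.elim
        · obtain ⟨rfl, hy⟩ := hy
          obtain ⟨z, hz, hφ⟩ := h y hy
          exact ⟨some ⟨_, z⟩, ⟨rfl, hz⟩, (ih _ z).2 hφ⟩
  refine ⟨U, ⟨none, trivial⟩, fun Γ δ h => ⟨some ⟨⟨(Γ, δ), h⟩, w _⟩, ?_, ?_⟩⟩
  · exact fun φ hφ => (key φ _ _).2 ((hN ⟨(Γ, δ), h⟩).1 φ hφ)
  · exact fun hδ => (hN ⟨(Γ, δ), h⟩).2 ((key δ _ _).1 hδ)

/-- A context to which no left rule applies proves a formula only by a right rule. The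
countermodel is a cluster of worlds, indexed by formulas, below a universal model. -/
theorem Dir.of_ent {Γ : Multiset Form} (hbot : Form.bot ∉ Γ)
    (hand : ∀ φ ψ, Form.and φ ψ ∉ Γ) (hor : ∀ φ ψ, Form.or φ ψ ∉ Γ)
    (himp : ∀ α χ, Form.imp α χ ∈ Γ → ¬ Dir Γ α) {δ : Form} (h : Ent Γ δ) : Dir Γ δ := by
  obtain ⟨U, ⟨u₀, hu₀⟩, hU⟩ := exists_universal_model
  let G : CKModel :=
    { W := U.W ⊕ Form
      le := fun a b => match a, b with
        | .inl x, .inl y => U.le x y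
        | .inr _, .inl y => U.forces Γ y
        | .inr _, .inr _ => True
        | .inl _, .inr _ => False
      R := fun a b => match a, b with
        | .inl x, .inl y => U.R x y
        | .inr i, .inl y => U.forces (boxInv Γ) y ∧ (U.force i y → Dir Γ i.dia)
        | _, .inr _ => False
      F := fun a => match a with
        | .inl x => U.F x
        | .inr _ => False
      V := fun a n => match a with
        | .inl x => U.V x n
        | .inr _ => Form.var n ∈ Γ
      le_refl := by
        rintro (x | i)
        · exact U.le_refl x
        · trivial
      le_trans := by
        rintro (x | i) (y | j) (z | k) h h' <;> try trivial
        · exact U.le_trans h h'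
        · exact CKModel.forces_le h' h
      F_le := by
        rintro (x | i) (y | j) h h' <;> try trivial
        exact U.F_le h h'
      F_R := by
        rintro (x | i) (y | j) h h' <;> try trivial
        exact U.F_R h h'
      F_serial := by
        rintro (x | i) h
        · obtain ⟨v, hv, hF⟩ := U.F_serial h
          exact ⟨.inl v, hv, hF⟩
        · exact h.elim
      V_le := by
        rintro (x | i) (y | j) n h h' <;> try trivial
        · exact U.V_le h h'
        · exact h _ h'
      V_F := by
        rintro (x | i) n h
        · exact U.V_F h
        · exact h.elim }
  have key : ∀ φ x, G.force φ (.inl x) ↔ U.force φ x := by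
    intro φ
    induction φ with
    | var n => exact fun _ => Iff.rfl
    | bot => exact fun _ => Iff.rfl
    | and φ ψ ih₁ ih₂ => exact fun x => and_congr (ih₁ x) (ih₂ x)
    | or φ ψ ih₁ ih₂ => exact fun x => or_congr (ih₁ x) (ih₂ x)
    | imp φ ψ ih₁ ih₂ =>
      intro x
      constructor
      · exact fun h y hy hφ => (ih₂ y).1 (h (.inl y) hy ((ih₁ y).2 hφ))
      · rintro h (y | j) hy hφ
        · exact (ih₂ y).2 (h y hy ((ih₁ y).1 hφ))
        · exact hy.elim
    | box φ ih =>
      intro x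
      constructor
      · exact fun h y hy z hz => (ih z).1 (h (.inl y) hy (.inl z) hz)
      · rintro h (y | j) hy (z | k) hz
        · exact (ih z).2 (h y hy z hz)
        · exact hz.elim
        · exact hy.elim
        · exact hy.elim
    | dia φ ih =>
      intro x
      constructor
      · intro h y hy
        obtain ⟨z | k, hz, hφ⟩ := h (.inl y) hy
        · exact ⟨z, hz, (ih z).1 hφ⟩
        · exact hz.elim
      · rintro h (y | j) hy
        · obtain ⟨z, hz, hφ⟩ := h y hy
          exact ⟨.inl z, hz, (ih z).2 hφ⟩
        · exact hy.elim
  have up : ∀ i φ, G.force φ (.inr i) → Ent Γ φ := by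
    intro i φ hφ
    by_contra hn
    obtain ⟨u, hu, hnu⟩ := hU _ _ hn
    exact hnu ((key φ u).1 (CKModel.force_le (M := G) (w := .inr i) (v := .inl u) hu hφ))
  have dir : ∀ i φ, G.force φ (.inr i) → Dir Γ φ := by
    intro i φ hφ
    cases φ with
    | var n => exact hφ
    | bot => exact hφ
    | and φ ψ => exact ⟨up i _ hφ.1, up i _ hφ.2⟩
    | or φ ψ => exact hφ.imp (up i _) (up i _)
    | imp φ ψ => exact up i _ hφ
    | box φ =>
      by_contra hn
      obtain ⟨u, hu, hnu⟩ := hU _ _ hn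
      refine hnu ((key φ u).1 (hφ (.inr .bot) trivial (.inl u) ⟨hu, fun hF => ?_⟩))
      exact (hnu (CKModel.force_of_F hF)).elim
    | dia φ =>
      obtain ⟨u | k, hu, hφu⟩ := hφ (.inr φ) trivial
      · exact hu.2 ((key φ u).1 hφu)
      · exact hu.elim
  refine dir .bot δ (h G _ fun θ hθ => ?_)
  cases θ with
  | var n => exact hθ
  | bot => exact (hbot hθ).elim
  | and φ ψ => exact (hand _ _ hθ).elim
  | or φ ψ => exact (hor _ _ hθ).elim
  | imp α χ =>
    rintro (u | j) hu hα
    · exact (key χ u).2 (hu _ hθ u (U.le_refl u) ((key α u).1 hα))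
    · exact (himp _ _ hθ (dir j α hα)).elim
  | box φ =>
    rintro (u | j) hu (v | k) hv
    · exact (key φ v).2 (hu _ hθ u (U.le_refl u) v hv)
    · exact hv.elim
    · exact (key φ v).2 (hv.1 _ (mem_boxInv.2 hθ))
    · exact hv.elim
  | dia γ =>
    rintro (u | j) hu
    · obtain ⟨v, hv, hγ⟩ := hu _ hθ u (U.le_refl u)
      exact ⟨.inl v, hv, (key γ v).2 hγ⟩
    · by_cases hj : Dir Γ j.dia
      · exact ⟨.inl u₀, ⟨fun _ _ => CKModel.force_of_F hu₀, fun _ => hj⟩,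
          (key γ u₀).2 (CKModel.force_of_F hu₀)⟩
      · have hn : ¬ Ent (γ ::ₘ boxInv Γ) j := fun hn => hj ⟨γ, hθ, hn⟩
        obtain ⟨v, hv, hnv⟩ := hU _ _ hn
        rw [CKModel.forces_cons] at hv
        exact ⟨.inl v, ⟨hv.2, fun h' => (hnv h').elim⟩, (key γ v).2 hv.1⟩

/-- The weight of a formula; it decreases along the rules of `G4`-style calculi. -/
def Form.weight : Form → ℕ
  | .var _ => 1
  | .bot => 1
  | .and φ ψ => φ.weight + ψ.weight + 2
  | .or φ ψ => φ.weight + ψ.weight + 1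
  | .imp φ ψ => φ.weight + ψ.weight + 1
  | .box φ => φ.weight + 1
  | .dia φ => φ.weight + 1

/-- An additive form of the multiset ordering on weights, for steps that replace one formula
by at most three lighter ones. -/
def Form.size (φ : Form) : ℕ := 4 ^ φ.weight

/-- The total size of a context. -/
def ctxSize (Γ : Multiset Form) : ℕ := (Γ.map Form.size).sum

@[simp] theorem ctxSize_cons (φ : Form) (Γ : Multiset Form) :
    ctxSize (φ ::ₘ Γ) = φ.size + ctxSize Γ := by
  simp [ctxSize]

theorem Form.size_pos (φ : Form) : 0 < φ.size := by
  unfold Form.size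
  positivity

theorem Form.size_lt {φ ψ : Form} (h : φ.weight < ψ.weight) : 4 * φ.size ≤ ψ.size := by
  unfold Form.size
  calc 4 * 4 ^ φ.weight = 4 ^ (φ.weight + 1) := by ring
    _ ≤ 4 ^ ψ.weight := Nat.pow_le_pow_right (by norm_num) h

theorem size_and_left (φ ψ : Form) : 4 * φ.size ≤ (φ.and ψ).size :=
  Form.size_lt (by simp only [Form.weight]; omega)

theorem size_and_right (φ ψ : Form) : 4 * ψ.size ≤ (φ.and ψ).size :=
  Form.size_lt (by simp only [Form.weight]; omega)

theorem size_or_left (φ ψ : Form) : 4 * φ.size ≤ (φ.or ψ).size :=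
  Form.size_lt (by simp only [Form.weight]; omega)

theorem size_or_right (φ ψ : Form) : 4 * ψ.size ≤ (φ.or ψ).size :=
  Form.size_lt (by simp only [Form.weight]; omega)

theorem size_imp_left (φ ψ : Form) : 4 * φ.size ≤ (φ.imp ψ).size :=
  Form.size_lt (by simp only [Form.weight]; omega)

theorem size_imp_right (φ ψ : Form) : 4 * ψ.size ≤ (φ.imp ψ).size :=
  Form.size_lt (by simp only [Form.weight]; omega)

theorem size_box (φ : Form) : 4 * φ.size ≤ φ.box.size :=
  Form.size_lt (by simp only [Form.weight]; omega)

theorem size_dia (φ : Form) : 4 * φ.size ≤ φ.dia.size :=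
  Form.size_lt (by simp only [Form.weight]; omega)

theorem size_imp_imp (φ ψ χ : Form) :
    4 * φ.size ≤ ((φ.imp ψ).imp χ).size ∧ 4 * ψ.size ≤ ((φ.imp ψ).imp χ).size ∧
      4 * (ψ.imp χ).size ≤ ((φ.imp ψ).imp χ).size :=
  ⟨Form.size_lt (by simp only [Form.weight]; omega),
    Form.size_lt (by simp only [Form.weight]; omega),
    Form.size_lt (by simp only [Form.weight]; omega)⟩

theorem boxInv_cons (φ : Form) (Γ : Multiset Form) :
    boxInv (φ ::ₘ Γ) = (match φ with | .box ψ => {ψ} | _ => 0) + boxInv Γ := by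
  unfold boxInv
  cases φ <;> first
    | (rw [Multiset.filterMap_cons_none _ _ rfl]; simp)
    | (rw [Multiset.filterMap_cons_some unboxF _ _ rfl]; simp)

theorem ctxSize_boxInv_le (Γ : Multiset Form) : ctxSize (boxInv Γ) ≤ ctxSize Γ := by
  induction Γ using Multiset.induction with
  | empty => simp [boxInv]
  | cons φ Γ ih =>
    rw [boxInv_cons, ctxSize_cons]
    cases φ <;> simp only [zero_add, Multiset.singleton_add, ctxSize_cons]
    case box ψ =>
      have := size_box ψ
      omega
    all_goals omega

theorem ctxSize_boxInv_cons_lt (φ : Form) (Γ : Multiset Form) :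
    ctxSize (boxInv (φ ::ₘ Γ)) < ctxSize (φ ::ₘ Γ) := by
  have h := ctxSize_boxInv_le Γ
  rw [boxInv_cons, ctxSize_cons]
  have := φ.size_pos
  cases φ <;> simp only [zero_add, Multiset.singleton_add, ctxSize_cons]
  case box ψ =>
    have := size_box ψ
    omega
  all_goals omega

theorem ctxSize_dia_boxInv_lt {Γ : Multiset Form} {γ : Form} (h : γ.dia ∈ Γ) :
    ctxSize (γ ::ₘ boxInv Γ) < ctxSize Γ := by
  obtain ⟨Δ, rfl⟩ := Multiset.exists_cons_of_mem h
  have h₁ := ctxSize_boxInv_le Δ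
  have h₂ := size_dia γ
  have h₃ := γ.size_pos
  rw [boxInv_cons]
  simp only [zero_add, ctxSize_cons]
  omega

/-- All variables of the context lie in `V`. -/
def Over (V : Set ℕ) (Γ : Multiset Form) : Prop := ∀ φ ∈ Γ, vars φ ⊆ V

@[simp] theorem over_zero (V : Set ℕ) : Over V 0 := by simp [Over]

@[simp] theorem over_cons {V : Set ℕ} {φ : Form} {Γ : Multiset Form} :
    Over V (φ ::ₘ Γ) ↔ vars φ ⊆ V ∧ Over V Γ := by
  simp [Over]

theorem Over.boxInv {V : Set ℕ} {Γ : Multiset Form} (h : Over V Γ) : Over V (boxInv Γ) :=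
  fun φ hφ => h φ.box (mem_boxInv.1 hφ)

/-- The set of formulas occurring in a context. -/
def ctxSet (Γ : Multiset Form) : Set Form := {φ | φ ∈ Γ}

@[simp] theorem ctxSet_cons (φ : Form) (Γ : Multiset Form) :
    ctxSet (φ ::ₘ Γ) = insert φ (ctxSet Γ) := by
  ext
  simp [ctxSet]

/-- Formulas to which no invertible left rule applies. -/
def Simple : Form → Prop
  | .bot => False
  | .and _ _ => False
  | .or _ _ => False
  | .imp (.and _ _) _ => False
  | .imp (.or _ _) _ => False
  | _ => True

/-- `Γ` is equivalent to the disjunction of the smaller contexts `Γ₁` and `Γ₂`. -/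
structure Splits (Γ Γ₁ Γ₂ : Multiset Form) : Prop where
  lt₁ : ctxSize Γ₁ < ctxSize Γ
  lt₂ : ctxSize Γ₂ < ctxSize Γ
  vars_sub : ∀ V, Over V Γ → Over V Γ₁ ∧ Over V Γ₂
  forces : ∀ (M : CKModel) (w : M.W), M.forces Γ w ↔ M.forces Γ₁ w ∨ M.forces Γ₂ w
  ckh : ∀ δ, CKH (ctxSet Γ₁) δ → CKH (ctxSet Γ₂) δ → CKH (ctxSet Γ) δ

theorem exists_splits (Γ : Multiset Form) :
    Form.bot ∈ Γ ∨ (∀ φ ∈ Γ, Simple φ) ∨ ∃ Γ₁ Γ₂, Splits Γ Γ₁ Γ₂ := by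
  by_cases hs : ∀ φ ∈ Γ, Simple φ
  · exact .inr (.inl hs)
  push Not at hs
  obtain ⟨θ, hθ, hns⟩ := hs
  obtain ⟨Δ, rfl⟩ := Multiset.exists_cons_of_mem hθ
  have el : ∀ {A : Set Form} {φ}, CKH (insert φ A) φ := .el (Set.mem_insert _ _)
  match θ, hns with
  | .bot, _ => exact .inl hθ
  | .and φ ψ, _ =>
    have h₁ := size_and_left φ ψ
    have h₂ := size_and_right φ ψ
    have h₃ := (φ.and ψ).size_pos
    have key : ctxSize (φ ::ₘ ψ ::ₘ Δ) < ctxSize (φ.and ψ ::ₘ Δ) := by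
      simp only [ctxSize_cons]; omega
    refine .inr (.inr ⟨φ ::ₘ ψ ::ₘ Δ, φ ::ₘ ψ ::ₘ Δ, key, key, ?_, ?_, ?_⟩)
    · simp [vars, and_assoc]
    · simp [CKModel.force, and_assoc]
    · simp only [ctxSet_cons]
      refine fun δ h _ => h.cut ?_
      rintro x (rfl | rfl | hx)
      · exact .mp el (.ax (.a6 _ _))
      · exact .mp el (.ax (.a7 _ _))
      · exact .el (.inr hx)
  | .or φ ψ, _ =>
    have h₁ := size_or_left φ ψ
    have h₂ := size_or_right φ ψ
    have h₃ := (φ.or ψ).size_pos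
    refine .inr (.inr ⟨φ ::ₘ Δ, ψ ::ₘ Δ, ?_, ?_, ?_, ?_, ?_⟩)
    · simp only [ctxSize_cons]; omega
    · simp only [ctxSize_cons]; omega
    · simp only [over_cons, vars, Set.union_subset_iff]
      tauto
    · simp [CKModel.force, or_and_right]
    · simp only [ctxSet_cons]
      exact fun δ h h' => CKH.or_elim el
        (h.mono (Set.insert_subset_insert (Set.subset_insert _ _)))
        (h'.mono (Set.insert_subset_insert (Set.subset_insert _ _)))
  | .imp (.and φ ψ) χ, _ =>
    have key : ctxSize (φ.imp (ψ.imp χ) ::ₘ Δ) < ctxSize ((φ.and ψ).imp χ ::ₘ Δ) := by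
      have h : 4 * (φ.imp (ψ.imp χ)).size ≤ ((φ.and ψ).imp χ).size :=
        Form.size_lt (by simp only [Form.weight]; omega)
      have := (φ.imp (ψ.imp χ)).size_pos
      simp only [ctxSize_cons]; omega
    refine .inr (.inr ⟨_, _, key, key, ?_, ?_, ?_⟩)
    · simp only [over_cons, vars, Set.union_subset_iff]
      tauto
    · intro M w
      simp only [CKModel.forces_cons, CKModel.force, or_self]
      refine and_congr_left fun _ => ⟨?_, ?_⟩
      · exact fun h v hv hφ u hu hψ =>
          h u (M.le_trans hv hu) ⟨CKModel.force_le hu hφ, hψ⟩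
      · exact fun h v hv hφ => h v hv hφ.1 v (M.le_refl v) hφ.2
    · simp only [ctxSet_cons]
      refine fun δ h _ => h.cut ?_
      rintro x (rfl | hx)
      · refine CKH.deduction (CKH.deduction (.mp (φ := φ.and ψ) ?_ ?_))
        · exact CKH.and_intro (.el (.inr (.inl rfl))) el
        · exact .el (.inr (.inr (.inl rfl)))
      · exact .el (.inr hx)
  | .imp (.or φ ψ) χ, _ =>
    have key : ctxSize (φ.imp χ ::ₘ ψ.imp χ ::ₘ Δ) < ctxSize ((φ.or ψ).imp χ ::ₘ Δ) := by
      have h : 4 * (φ.imp χ).size ≤ ((φ.or ψ).imp χ).size :=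
        Form.size_lt (by simp only [Form.weight]; omega)
      have h' : 4 * (ψ.imp χ).size ≤ ((φ.or ψ).imp χ).size :=
        Form.size_lt (by simp only [Form.weight]; omega)
      have := (φ.imp χ).size_pos
      simp only [ctxSize_cons]; omega
    refine .inr (.inr ⟨_, _, key, key, ?_, ?_, ?_⟩)
    · simp only [over_cons, vars, Set.union_subset_iff]
      tauto
    · intro M w
      simp only [CKModel.forces_cons, CKModel.force, or_self, ← and_assoc]
      refine and_congr_left fun _ => ⟨?_, ?_⟩
      · exact fun h => ⟨fun v hv hφ => h v hv (.inl hφ), fun v hv hψ => h v hv (.inr hψ)⟩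
      · exact fun h v hv hφ => hφ.elim (h.1 v hv) (h.2 v hv)
    · simp only [ctxSet_cons]
      refine fun δ h _ => h.cut ?_
      rintro x (rfl | rfl | hx)
      · exact CKH.deduction (.mp (.mp el (.ax (.a3 _ _))) (.el (.inr (.inl rfl))))
      · exact CKH.deduction (.mp (.mp el (.ax (.a4 _ _))) (.el (.inr (.inl rfl))))
      · exact .el (.inr hx)
  | .var _, h => exact (h trivial).elim
  | .box _, h => exact (h trivial).elim
  | .dia _, h => exact (h trivial).elim
  | .imp (.var _) _, h => exact (h trivial).elim
  | .imp .bot _, h => exact (h trivial).elim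
  | .imp (.imp _ _) _, h => exact (h trivial).elim
  | .imp (.box _) _, h => exact (h trivial).elim
  | .imp (.dia _) _, h => exact (h trivial).elim

/-- In a simple context, a consequence comes from a right rule or after firing an implication. -/
theorem Dir.of_simple {Γ : Multiset Form} (hs : ∀ φ ∈ Γ, Simple φ) {δ : Form} (h : Ent Γ δ) :
    Dir Γ δ ∨ ∃ α χ, Form.imp α χ ∈ Γ ∧ Dir Γ α := by
  by_cases hf : ∃ α χ, Form.imp α χ ∈ Γ ∧ Dir Γ α
  · exact .inr hf
  · push Not at hf
    exact .inl (Dir.of_ent (fun h => hs _ h) (fun _ _ h => hs _ h) (fun _ _ h => hs _ h) hf h)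

theorem Ent.imp_intro {Γ : Multiset Form} {φ ψ : Form} (h : Ent Γ (φ.imp ψ)) :
    Ent (φ ::ₘ Γ) ψ := by
  intro M w hw
  rw [CKModel.forces_cons] at hw
  exact h M w hw.2 w (M.le_refl w) hw.1

theorem Ent.imp_elim {Γ : Multiset Form} {φ ψ : Form} (h : Ent (φ ::ₘ Γ) ψ) :
    Ent Γ (φ.imp ψ) := by
  intro M w hw v hv hφ
  exact h M v (by simp [hφ, CKModel.forces_le hv hw])

/-- An implication with an implication as antecedent simplifies once that antecedent's own
antecedent holds. -/
theorem CKModel.force_imp_imp {M : CKModel} {φ ψ χ : Form} {w : M.W} (h : M.force φ w)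
    (h' : M.force (ψ.imp χ) w) : M.force ((φ.imp ψ).imp χ) w :=
  fun v hv hφψ => h' v hv (hφψ v (M.le_refl v) (CKModel.force_le hv h))

theorem ent_of_CKH {φ : Form} (h : CKH ∅ φ) : Ent 0 φ :=
  fun _ w _ => CKModel.force_of_CKH h w (by simp)

/-- Completeness of the Hilbert calculus. -/
theorem CKH_of_ent {Γ : Multiset Form} {δ : Form} (h : Ent Γ δ) : CKH (ctxSet Γ) δ := by
  induction hn : ctxSize Γ + δ.size using Nat.strong_induction_on generalizing Γ δ with
  | _ n ih =>
  subst hn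
  have ih' : ∀ {Δ θ}, Ent Δ θ → ctxSize Δ + θ.size < ctxSize Γ + δ.size →
      CKH (ctxSet Δ) θ := fun h hlt => ih _ hlt h rfl
  clear ih
  have hδ := δ.size_pos
  rcases exists_splits Γ with hb | hs | ⟨Γ₁, Γ₂, hsp⟩
  · exact .mp (.el hb) (.ax (.a9 _))
  · rcases Dir.of_simple hs h with hd | ⟨α, χ, hm, hd⟩
    · cases δ with
      | var n => exact .el hd
      | bot => exact hd.elim
      | and φ ψ =>
        have := size_and_left φ ψ
        have := size_and_right φ ψ
        exact CKH.and_intro (ih' hd.1 (by omega)) (ih' hd.2 (by omega))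
      | or φ ψ =>
        have := size_or_left φ ψ
        have := size_or_right φ ψ
        rcases hd with hd | hd
        · exact .mp (ih' hd (by omega)) (.ax (.a3 _ _))
        · exact .mp (ih' hd (by omega)) (.ax (.a4 _ _))
      | imp φ ψ =>
        have := size_imp_left φ ψ
        have := size_imp_right φ ψ
        have := ih' hd.imp_intro (by simp only [ctxSize_cons]; omega)
        rw [ctxSet_cons] at this
        exact this.deduction
      | box φ =>
        have := size_box φ
        have := ctxSize_boxInv_le Γ
        exact CKH.box_of (ih' hd (by omega)) (fun ψ hψ => mem_boxInv.1 hψ)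
      | dia φ =>
        obtain ⟨γ, hγ, hd⟩ := hd
        have := size_dia φ
        have := ctxSize_dia_boxInv_lt hγ
        have := ih' hd (by omega)
        rw [ctxSet_cons] at this
        exact CKH.dia_of this (fun ψ hψ => mem_boxInv.1 hψ) hγ
    · obtain ⟨Δ, rfl⟩ := Multiset.exists_cons_of_mem hm
      have h₁ := size_imp_left α χ
      have h₂ := size_imp_right α χ
      have h₃ := χ.size_pos
      have h₄ := α.size_pos
      have hα : CKH (ctxSet (α.imp χ ::ₘ Δ)) α := by
        cases α with
        | var n => exact .el hd
        | bot => exact hd.elim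
        | and φ ψ => exact (hs _ hm).elim
        | or φ ψ => exact (hs _ hm).elim
        | imp φ ψ =>
          have h₅ := size_imp_imp φ ψ χ
          have : Ent (φ ::ₘ ψ.imp χ ::ₘ Δ) ψ := by
            intro M w hw
            simp only [CKModel.forces_cons] at hw
            refine hd M w ?_ w (M.le_refl w) hw.1
            simp [hw.2.2, CKModel.force_imp_imp hw.1 hw.2.1]
          have := ih' this (by simp only [ctxSize_cons]; omega)
          simp only [ctxSet_cons] at this ⊢
          refine CKH.deduction (this.cut ?_)
          rintro x (rfl | rfl | hx)
          · exact .el (.inl rfl)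
          · refine CKH.deduction (.mp (φ := φ.imp ψ) ?_ (.el (.inr (.inr (.inl rfl)))))
            exact CKH.weaken_imp (.el (.inl rfl))
          · exact .el (.inr (.inr hx))
        | box φ =>
          have := size_box φ
          have := ctxSize_boxInv_le (φ.box.imp χ ::ₘ Δ)
          simp only [ctxSize_cons] at this ih'
          have hφ : φ.size < (φ.box.imp χ).size := by have := φ.size_pos; omega
          have := ctxSize_boxInv_le Δ
          rw [Dir, boxInv_cons, zero_add] at hd
          rw [ctxSet_cons]
          exact CKH.box_of (ih' hd (by omega)) (fun ψ hψ => .inr <| mem_boxInv.1 hψ)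
        | dia φ =>
          obtain ⟨γ, hγ, hd⟩ := hd
          have := size_dia φ
          replace hγ : γ.dia ∈ Δ := by simpa using hγ
          rw [boxInv_cons, zero_add] at hd
          have := ctxSize_dia_boxInv_lt hγ
          simp only [ctxSize_cons] at this ih'
          have := ih' hd (by simp only [ctxSize_cons]; omega)
          rw [ctxSet_cons] at this ⊢
          exact CKH.dia_of this (fun ψ hψ => .inr <| mem_boxInv.1 hψ) (.inr hγ)
      have hχ : Ent (χ ::ₘ Δ) δ := by
        intro M w hw
        rw [CKModel.forces_cons] at hw
        refine h M w ?_
        rw [CKModel.forces_cons]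
        exact ⟨fun v hv _ => CKModel.force_le hv hw.1, hw.2⟩
      refine (ih' hχ (by simp only [ctxSize_cons]; omega)).cut ?_
      simp only [ctxSet_cons] at hα ⊢
      rintro x (rfl | hx)
      · exact .mp hα (.el (.inl rfl))
      · exact .el (.inr hx)
  · have h₁ := hsp.lt₁
    have h₂ := hsp.lt₂
    exact hsp.ckh δ (ih' (fun M w hw => h M w ((hsp.forces M w).2 (.inl hw))) (by omega))
      (ih' (fun M w hw => h M w ((hsp.forces M w).2 (.inr hw))) (by omega))

/-- `e` is the strongest `p`-free consequence of `Γ`, and has variables in `V`. -/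
structure IsExists (p : ℕ) (V : Set ℕ) (Γ : Multiset Form) (e : Form) : Prop where
  vars_sub : vars e ⊆ V
  ent : Ent Γ e
  uniform : ∀ S ψ, Over {p}ᶜ S → vars ψ ⊆ {p}ᶜ → Ent (Γ + S) ψ → Ent (e ::ₘ S) ψ

/-- `a` is the weakest `p`-free formula that entails `δ` over `Γ`, and has variables in `V`. -/
structure IsForall (p : ℕ) (V : Set ℕ) (Γ : Multiset Form) (δ a : Form) : Prop where
  vars_sub : vars a ⊆ V
  ent : Ent (a ::ₘ Γ) δ
  uniform : ∀ S, Over {p}ᶜ S → Ent (Γ + S) δ → Ent S a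

theorem exists_conj {V : Set ℕ} (Γ : Multiset Form) (f : Form → Form)
    (hf : ∀ θ ∈ Γ, vars (f θ) ⊆ V) :
    ∃ e, vars e ⊆ V ∧ ∀ (M : CKModel) (w : M.W), M.force e w ↔ ∀ θ ∈ Γ, M.force (f θ) w := by
  induction Γ using Multiset.induction with
  | empty => exact ⟨Form.bot.imp .bot, by simp [vars], fun M w => by simp [CKModel.force]⟩
  | cons θ Γ ih =>
    obtain ⟨e, he, h⟩ := ih fun θ' hθ' => hf θ' (Multiset.mem_cons_of_mem hθ')
    refine ⟨(f θ).and e, Set.union_subset (hf θ (Multiset.mem_cons_self θ Γ)) he, fun M w => ?_⟩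
    simp [CKModel.force, h]

theorem exists_disj {V : Set ℕ} (Γ : Multiset Form) (f : Form → Form)
    (hf : ∀ θ ∈ Γ, vars (f θ) ⊆ V) :
    ∃ e, vars e ⊆ V ∧ ∀ (M : CKModel) (w : M.W),
      M.force e w ↔ M.F w ∨ ∃ θ ∈ Γ, M.force (f θ) w := by
  induction Γ using Multiset.induction with
  | empty => exact ⟨.bot, by simp [vars], fun M w => by simp [CKModel.force]⟩
  | cons θ Γ ih =>
    obtain ⟨e, he, h⟩ := ih fun θ' hθ' => hf θ' (Multiset.mem_cons_of_mem hθ')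
    refine ⟨(f θ).or e, Set.union_subset (hf θ (Multiset.mem_cons_self θ Γ)) he, fun M w => ?_⟩
    simp [CKModel.force, h]
    tauto

theorem Ent.bot_elim {Γ : Multiset Form} (h : Form.bot ∈ Γ) (δ : Form) : Ent Γ δ :=
  fun _ _ hw => CKModel.force_of_F (hw _ h)

theorem Ent.of_forces {Γ Δ : Multiset Form} {δ : Form} (h : Ent Δ δ)
    (hs : ∀ (M : CKModel) (w : M.W), M.forces Γ w → M.forces Δ w) : Ent Γ δ :=
  fun M w hw => h M w (hs M w hw)

theorem Ent.box_cons {Γ : Multiset Form} {φ ψ : Form} (h : Ent (φ ::ₘ boxInv Γ) ψ) :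
    Ent (φ.box ::ₘ Γ) ψ.box :=
  Dir.ent (α := ψ.box) (by simpa [Dir, boxInv_cons] using h)

theorem Ent.dia_cons {Γ : Multiset Form} {φ ψ : Form} (h : Ent (φ ::ₘ boxInv Γ) ψ) :
    Ent (φ.dia ::ₘ Γ) ψ.dia :=
  Dir.ent (α := ψ.dia) ⟨φ, Multiset.mem_cons_self _ _, by simpa [boxInv_cons] using h⟩

/-- A fired implication can be replaced by its conclusion. -/
theorem forces_fire {M : CKModel} {Γ : Multiset Form} {α χ : Form} {w : M.W}
    (hα : M.force α w) : M.forces (α.imp χ ::ₘ Γ) w ↔ M.forces (χ ::ₘ Γ) w := by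
  simp only [CKModel.forces_cons]
  exact and_congr_left fun _ => ⟨fun h => h w (M.le_refl w) hα,
    fun h v hv _ => CKModel.force_le hv h⟩

theorem Ent.fire {Γ : Multiset Form} {α χ δ : Form} (h : Ent (α.imp χ ::ₘ Γ) δ) :
    Ent (χ ::ₘ Γ) δ :=
  h.of_forces fun M w hw => by
    rw [CKModel.forces_cons] at hw ⊢
    exact ⟨fun v hv _ => CKModel.force_le hv hw.1, hw.2⟩

theorem Ent.unfire {Γ : Multiset Form} {α χ δ : Form} (hα : Ent (α.imp χ ::ₘ Γ) α)
    (h : Ent (χ ::ₘ Γ) δ) : Ent (α.imp χ ::ₘ Γ) δ :=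
  h.of_forces fun M w hw => (forces_fire (hα M w hw)).1 hw

theorem Ent.imp_imp {Γ : Multiset Form} {φ ψ χ : Form}
    (h : Ent ((φ.imp ψ).imp χ ::ₘ Γ) (φ.imp ψ)) : Ent (φ ::ₘ ψ.imp χ ::ₘ Γ) ψ :=
  h.imp_intro.of_forces fun M w hw => by
    simp only [CKModel.forces_cons] at hw ⊢
    exact ⟨hw.1, CKModel.force_imp_imp hw.1 hw.2.1, hw.2.2⟩

theorem Ent.imp_imp_symm {Γ : Multiset Form} {φ ψ χ : Form}
    (h : Ent (φ ::ₘ ψ.imp χ ::ₘ Γ) ψ) : Ent ((φ.imp ψ).imp χ ::ₘ Γ) (φ.imp ψ) :=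
  Ent.imp_elim <| h.of_forces fun M w hw => by
    simp only [CKModel.forces_cons] at hw ⊢
    exact ⟨hw.1, fun v hv hψ => hw.2.1 v hv fun u hu _ => CKModel.force_le hu hψ, hw.2.2⟩

theorem Dir.of_cons_imp {Γ : Multiset Form} {α β χ : Form} (h : Dir (β.imp χ ::ₘ Γ) α)
    (hand : ∀ φ ψ, α ≠ .and φ ψ) (hor : ∀ φ ψ, α ≠ .or φ ψ) (himp : ∀ φ ψ, α ≠ .imp φ ψ) :
    Dir Γ α := by
  cases α with
  | var n => simpa [Dir] using h
  | bot => exact h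
  | and φ ψ => exact (hand _ _ rfl).elim
  | or φ ψ => exact (hor _ _ rfl).elim
  | imp φ ψ => exact (himp _ _ rfl).elim
  | box φ => simpa [Dir, boxInv_cons] using h
  | dia φ => simpa [Dir, boxInv_cons] using h

section Interpolants

variable {p : ℕ} {V : Set ℕ}

theorem exists_isExists_of_or {Γ Γ₁ Γ₂ : Multiset Form}
    (h : ∀ (M : CKModel) (w : M.W), M.forces Γ w ↔ M.forces Γ₁ w ∨ M.forces Γ₂ w)
    (h₁ : ∃ e, IsExists p V Γ₁ e) (h₂ : ∃ e, IsExists p V Γ₂ e) : ∃ e, IsExists p V Γ e := by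
  obtain ⟨e₁, h₁⟩ := h₁
  obtain ⟨e₂, h₂⟩ := h₂
  refine ⟨e₁.or e₂, Set.union_subset h₁.vars_sub h₂.vars_sub, ?_, ?_⟩
  · exact fun M w hw => ((h M w).1 hw).imp (h₁.ent M w) (h₂.ent M w)
  · intro S ψ hS hψ hent M w hw
    rw [CKModel.forces_cons] at hw
    rcases hw.1 with he | he
    · refine h₁.uniform S ψ hS hψ (hent.of_forces fun M w hw => ?_) M w
        (CKModel.forces_cons.2 ⟨he, hw.2⟩)
      rw [CKModel.forces_add] at hw ⊢
      exact ⟨(h M w).2 (.inl hw.1), hw.2⟩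
    · refine h₂.uniform S ψ hS hψ (hent.of_forces fun M w hw => ?_) M w
        (CKModel.forces_cons.2 ⟨he, hw.2⟩)
      rw [CKModel.forces_add] at hw ⊢
      exact ⟨(h M w).2 (.inr hw.1), hw.2⟩

theorem exists_isForall_of_or {Γ Γ₁ Γ₂ : Multiset Form} {δ : Form}
    (h : ∀ (M : CKModel) (w : M.W), M.forces Γ w ↔ M.forces Γ₁ w ∨ M.forces Γ₂ w)
    (h₁ : ∃ a, IsForall p V Γ₁ δ a) (h₂ : ∃ a, IsForall p V Γ₂ δ a) :
    ∃ a, IsForall p V Γ δ a := by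
  obtain ⟨a₁, h₁⟩ := h₁
  obtain ⟨a₂, h₂⟩ := h₂
  refine ⟨a₁.and a₂, Set.union_subset h₁.vars_sub h₂.vars_sub, ?_, ?_⟩
  · intro M w hw
    rw [CKModel.forces_cons] at hw
    rcases (h M w).1 hw.2 with hw' | hw'
    · exact h₁.ent M w (CKModel.forces_cons.2 ⟨hw.1.1, hw'⟩)
    · exact h₂.ent M w (CKModel.forces_cons.2 ⟨hw.1.2, hw'⟩)
  · refine fun S hS hent M w hw => ⟨h₁.uniform S hS (hent.of_forces fun M w hw => ?_) M w hw,
      h₂.uniform S hS (hent.of_forces fun M w hw => ?_) M w hw⟩ <;>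
      rw [CKModel.forces_add] at hw ⊢
    · exact ⟨(h M w).2 (.inl hw.1), hw.2⟩
    · exact ⟨(h M w).2 (.inr hw.1), hw.2⟩

/-- The weakest `p`-free condition under which `α` follows from `Γ` by a right rule. -/
theorem exists_right_condition {Γ : Multiset Form} {α : Form} (hΓ : Over (insert p V) Γ)
    (hα : vars α ⊆ insert p V)
    (hand : ∀ φ ψ, α ≠ .and φ ψ) (hor : ∀ φ ψ, α ≠ .or φ ψ) (himp : ∀ φ ψ, α ≠ .imp φ ψ)
    (ih : ∀ Δ δ, Over (insert p V) Δ → vars δ ⊆ insert p V →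
      ctxSize Δ + δ.size < ctxSize Γ + α.size → ∃ a, IsForall p V Δ δ a) :
    ∃ c, vars c ⊆ V ∧ Ent (c ::ₘ Γ) α ∧
      ∀ S, Over {p}ᶜ S → Dir (Γ + S) α → Ent S c := by
  have hbox := ctxSize_boxInv_le Γ
  cases α with
  | var n =>
    by_cases hn : Form.var n ∈ Γ
    · exact ⟨Form.bot.imp .bot, by simp [vars],
        fun M w hw => hw _ (Multiset.mem_cons_of_mem hn), fun S _ _ M w _ v _ h => h⟩
    have hS : ∀ S, Dir (Γ + S) (.var n) → Form.var n ∈ S :=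
      fun S h => (Multiset.mem_add.1 h).resolve_left hn
    by_cases hp : n = p
    · subst hp
      refine ⟨.bot, by simp [vars], Ent.bot_elim (Multiset.mem_cons_self _ _) _, ?_⟩
      intro S hP h
      simpa [vars] using hP _ (hS S h)
    · refine ⟨.var n, ?_, fun M w hw => hw _ (Multiset.mem_cons_self _ _),
        fun S hP h M w hw => hw _ (hS S h)⟩
      simpa [vars, hp] using hα
  | bot => exact ⟨.bot, by simp [vars], Ent.bot_elim (Multiset.mem_cons_self _ _) _,
      fun S _ h => h.elim⟩
  | and φ ψ => exact (hand _ _ rfl).elim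
  | or φ ψ => exact (hor _ _ rfl).elim
  | imp φ ψ => exact (himp _ _ rfl).elim
  | box φ =>
    have := size_box φ
    have := φ.size_pos
    obtain ⟨a, ha⟩ := ih (boxInv Γ) φ hΓ.boxInv hα (by omega)
    refine ⟨a.box, ha.vars_sub, Ent.box_cons ha.ent, fun S hS h => ?_⟩
    rw [Dir, boxInv_add] at h
    exact Dir.ent (α := a.box) (ha.uniform _ hS.boxInv h)
  | dia φ =>
    have hs := size_dia φ
    have hs' := φ.size_pos
    obtain ⟨a, ha⟩ := ih (boxInv Γ) φ hΓ.boxInv hα (by omega)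
    have hf : ∀ θ, ∃ g, θ ∈ Γ → vars g ⊆ V ∧ Ent (g ::ₘ Γ) φ.dia ∧
        ∀ γ, θ = .dia γ → ∀ S, Over {p}ᶜ S → Ent (γ ::ₘ boxInv (Γ + S)) φ → Ent S g := by
      intro θ
      by_cases hθ : θ ∈ Γ
      swap
      · exact ⟨.bot, fun h => (hθ h).elim⟩
      by_cases hd : ∃ γ, θ = .dia γ
      · obtain ⟨γ, rfl⟩ := hd
        have := ctxSize_dia_boxInv_lt hθ
        obtain ⟨g, hg⟩ := ih (γ ::ₘ boxInv Γ) φ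
          (over_cons.2 ⟨hΓ γ.dia hθ, hΓ.boxInv⟩) hα (by omega)
        refine ⟨g.box, fun _ => ⟨hg.vars_sub, ?_, ?_⟩⟩
        · refine Dir.ent (α := φ.dia) ⟨γ, Multiset.mem_cons_of_mem hθ, ?_⟩
          simpa [boxInv_cons, Multiset.cons_swap] using hg.ent
        · rintro γ' ⟨⟩ S hS h
          refine Dir.ent (α := g.box) (hg.uniform _ hS.boxInv ?_)
          simpa [boxInv_add] using h
      · exact ⟨.bot, fun _ => ⟨by simp [vars], Ent.bot_elim (Multiset.mem_cons_self _ _) _,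
          fun γ h => (hd ⟨γ, h⟩).elim⟩⟩
    choose f hf using hf
    obtain ⟨d, hd, hdf⟩ := exists_disj Γ f fun θ hθ => (hf θ hθ).1
    refine ⟨a.dia.or d, Set.union_subset ha.vars_sub hd, ?_, ?_⟩
    · intro M w hw
      rw [CKModel.forces_cons] at hw
      rcases hw.1 with h | h
      · exact Ent.dia_cons ha.ent M w (CKModel.forces_cons.2 ⟨h, hw.2⟩)
      · rcases (hdf M w).1 h with h | ⟨θ, hθ, h⟩
        · exact CKModel.force_of_F h
        · exact (hf θ hθ).2.1 M w (CKModel.forces_cons.2 ⟨h, hw.2⟩)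
    · rintro S hS ⟨γ, hγ, h⟩ M w hw
      rcases Multiset.mem_add.1 hγ with hγ | hγ
      · exact .inr ((hdf M w).2 (.inr ⟨_, hγ, (hf _ hγ).2.2 γ rfl S hS h M w hw⟩))
      · refine .inl (Dir.ent (α := a.dia) ⟨γ, hγ, ?_⟩ M w hw)
        refine ha.uniform _ (over_cons.2 ⟨hS γ.dia hγ, hS.boxInv⟩) ?_
        simpa [boxInv_add] using h

/-- The weakest `p`-free condition under which an implication of a context fires. -/
theorem exists_firing_condition {Δ : Multiset Form} {α χ : Form}
    (hΓ : Over (insert p V) (α.imp χ ::ₘ Δ)) (hs : Simple (α.imp χ))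
    (ih : ∀ Δ' δ, Over (insert p V) Δ' → vars δ ⊆ insert p V →
      ctxSize Δ' + δ.size < ctxSize (α.imp χ ::ₘ Δ) → ∃ a, IsForall p V Δ' δ a) :
    ∃ c, vars c ⊆ V ∧ Ent (c ::ₘ α.imp χ ::ₘ Δ) α ∧
      ∀ S, Over {p}ᶜ S → Dir (α.imp χ ::ₘ Δ + S) α → Ent S c := by
  have h₁ := size_imp_left α χ
  have h₂ := α.size_pos
  simp only [over_cons, vars, Set.union_subset_iff] at hΓ
  simp only [ctxSize_cons] at ih
  by_cases himp : ∃ φ ψ, α = .imp φ ψ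
  · obtain ⟨φ, ψ, rfl⟩ := himp
    have h₃ := size_imp_imp φ ψ χ
    have hv := hΓ.1.1
    simp only [vars, Set.union_subset_iff] at hv
    obtain ⟨a, ha⟩ := ih (φ ::ₘ ψ.imp χ ::ₘ Δ) ψ (by simp [vars, hv, hΓ]) hv.2
      (by simp only [ctxSize_cons]; omega)
    refine ⟨a, ha.vars_sub, ?_, fun S hS h => ?_⟩
    · rw [Multiset.cons_swap]
      refine Ent.imp_imp_symm (ha.ent.of_forces fun M w hw => ?_)
      simp only [CKModel.forces_cons] at hw ⊢
      tauto
    · refine ha.uniform S hS ?_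
      simp only [Multiset.cons_add] at h ⊢
      exact Ent.imp_imp h
  · have hand : ∀ φ ψ, α ≠ .and φ ψ := by rintro φ ψ rfl; exact hs
    have hor : ∀ φ ψ, α ≠ .or φ ψ := by rintro φ ψ rfl; exact hs
    have himp' : ∀ φ ψ, α ≠ .imp φ ψ := fun φ ψ h => himp ⟨φ, ψ, h⟩
    obtain ⟨c, hc, hent, hc'⟩ := exists_right_condition hΓ.2 hΓ.1.1 hand hor himp'
      fun Δ' δ h h' hlt => ih Δ' δ h h' (by omega)
    refine ⟨c, hc, hent.of_forces fun M w hw => ?_, fun S hS h => hc' S hS ?_⟩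
    · simp only [CKModel.forces_cons] at hw ⊢
      tauto
    · rw [Multiset.cons_add] at h
      exact h.of_cons_imp hand hor himp'

/-- The properties of a conjunction `e` of `p`-free consequences of `Γ` that account for the rules
involving `Γ` as a whole, its variables, and its formulas `◇γ`. -/
structure ModalClauses (p : ℕ) (V : Set ℕ) (Γ : Multiset Form) (e : Form) : Prop where
  var : ∀ n, Form.var n ∈ Γ → n ≠ p → Ent {e} (.var n)
  box : ∃ e', IsExists p V (boxInv Γ) e' ∧ Ent {e} e'.box
  dia : ∀ γ, Form.dia γ ∈ Γ → ∃ e', IsExists p V (γ ::ₘ boxInv Γ) e' ∧ Ent {e} e'.dia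

theorem ModalClauses.ent {Γ S : Multiset Form} {e ψ : Form} (he : ModalClauses p V Γ e)
    (hS : Over {p}ᶜ S) (hψ : vars ψ ⊆ {p}ᶜ)
    (hand : ∀ φ φ', ψ ≠ .and φ φ') (hor : ∀ φ φ', ψ ≠ .or φ φ') (himp : ∀ φ φ', ψ ≠ .imp φ φ')
    (h : Dir (Γ + S) ψ) : Ent (e ::ₘ S) ψ := by
  have sub : ∀ {c θ}, Ent {e} c → Ent (c ::ₘ S) θ → Ent (e ::ₘ S) θ := by
    intro c θ hc hθ
    refine hθ.of_forces fun M w hw => ?_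
    rw [CKModel.forces_cons] at hw ⊢
    exact ⟨hc M w (by simpa [CKModel.forces] using hw.1), hw.2⟩
  obtain ⟨e₀, he₀, hee₀⟩ := he.box
  cases ψ with
  | var n =>
    rcases Multiset.mem_add.1 h with h | h
    · exact sub (he.var n h (by simpa [vars, eq_comm] using hψ))
        fun M w hw => hw _ (Multiset.mem_cons_self _ _)
    · exact fun M w hw => hw _ (Multiset.mem_cons_of_mem h)
  | bot => exact h.elim
  | and φ ψ => exact (hand _ _ rfl).elim
  | or φ ψ => exact (hor _ _ rfl).elim
  | imp φ ψ => exact (himp _ _ rfl).elim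
  | box φ =>
    rw [Dir, boxInv_add] at h
    exact sub hee₀ (Ent.box_cons (he₀.uniform _ _ hS.boxInv hψ h))
  | dia φ =>
    obtain ⟨γ, hγ, h⟩ := h
    rw [boxInv_add] at h
    rcases Multiset.mem_add.1 hγ with hγ | hγ
    · obtain ⟨e₁, he₁, hee₁⟩ := he.dia γ hγ
      exact sub hee₁ (Ent.dia_cons (he₁.uniform _ _ hS.boxInv hψ (by simpa using h)))
    · refine sub hee₀ (Dir.ent (α := φ.dia) ⟨γ, Multiset.mem_cons_of_mem hγ, ?_⟩)
      have := he₀.uniform (γ ::ₘ boxInv S) φ (over_cons.2 ⟨hS γ.dia hγ, hS.boxInv⟩) hψ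
        (by simpa using h)
      simpa [boxInv_cons, Multiset.cons_swap] using this

/-- The clause of a `p`-free consequence of `Γ` that accounts for firing `α → χ ∈ Γ`. -/
def FiringClause (p : ℕ) (Γ : Multiset Form) (e α : Form) : Prop :=
  ∀ S ψ, Over {p}ᶜ S → vars ψ ⊆ {p}ᶜ → Ent (Γ + S) ψ → Dir (Γ + S) α → Ent (e ::ₘ S) ψ

theorem isExists_of_clauses {Γ : Multiset Form} {e : Form} (hs : ∀ φ ∈ Γ, Simple φ)
    (hv : vars e ⊆ V) (hΓe : Ent Γ e) (he : ModalClauses p V Γ e)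
    (hf : ∀ α χ, Form.imp α χ ∈ Γ → FiringClause p Γ e α) : IsExists p V Γ e := by
  refine ⟨hv, hΓe, ?_⟩
  intro S ψ hS hψ h
  induction hn : ctxSize S + ψ.size using Nat.strong_induction_on generalizing S ψ with
  | _ n ih =>
  subst hn
  have ih' : ∀ {S' ψ'}, Ent (Γ + S') ψ' → Over {p}ᶜ S' → vars ψ' ⊆ {p}ᶜ →
      ctxSize S' + ψ'.size < ctxSize S + ψ.size → Ent (e ::ₘ S') ψ' :=
    fun h hS hψ hlt => ih _ hlt _ _ hS hψ h rfl
  clear ih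
  rcases exists_splits S with hb | hsS | ⟨S₁, S₂, hsp⟩
  · exact Ent.bot_elim (Multiset.mem_cons_of_mem hb) _
  · have hs' : ∀ φ ∈ Γ + S, Simple φ :=
      fun φ hφ => (Multiset.mem_add.1 hφ).elim (hs φ) (hsS φ)
    rcases Dir.of_simple hs' h with hd | ⟨α, χ, hm, hd⟩
    · by_cases hand : ∃ φ φ', ψ = .and φ φ'
      · obtain ⟨φ, φ', rfl⟩ := hand
        have := size_and_left φ φ'
        have := size_and_right φ φ'
        have := (φ.and φ').size_pos
        simp only [vars, Set.union_subset_iff] at hψ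
        exact fun M w hw =>
          ⟨ih' hd.1 hS hψ.1 (by omega) M w hw, ih' hd.2 hS hψ.2 (by omega) M w hw⟩
      by_cases hor : ∃ φ φ', ψ = .or φ φ'
      · obtain ⟨φ, φ', rfl⟩ := hor
        have := size_or_left φ φ'
        have := size_or_right φ φ'
        have := (φ.or φ').size_pos
        simp only [vars, Set.union_subset_iff] at hψ
        exact fun M w hw => hd.imp (fun h => ih' h hS hψ.1 (by omega) M w hw)
          (fun h => ih' h hS hψ.2 (by omega) M w hw)
      by_cases himp : ∃ φ φ', ψ = .imp φ φ'
      · obtain ⟨φ, φ', rfl⟩ := himp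
        have := size_imp_left φ φ'
        have := size_imp_right φ φ'
        have := (φ.imp φ').size_pos
        simp only [vars, Set.union_subset_iff] at hψ
        have h₁ := ih' (S' := φ ::ₘ S) (by simpa using hd.imp_intro)
          (over_cons.2 ⟨hψ.1, hS⟩) hψ.2 (by simp only [ctxSize_cons]; omega)
        rw [Multiset.cons_swap] at h₁
        exact h₁.imp_elim
      push Not at hand hor himp
      exact he.ent hS hψ hand hor himp hd
    · rcases Multiset.mem_add.1 hm with hm | hm
      · exact hf α χ hm S ψ hS hψ h hd
      · obtain ⟨S, rfl⟩ := Multiset.exists_cons_of_mem hm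
        have hsα := hsS _ hm
        have h₁ := size_imp_left α χ
        have h₂ := size_imp_right α χ
        have h₃ := α.size_pos
        have h₄ := χ.size_pos
        have hS' := hS
        simp only [over_cons, vars, Set.union_subset_iff] at hS
        simp only [ctxSize_cons] at ih'
        have hα : Ent (e ::ₘ α.imp χ ::ₘ S) α := by
          by_cases himp : ∃ φ φ', α = .imp φ φ'
          · obtain ⟨φ, ψ, rfl⟩ := himp
            have h₅ := size_imp_imp φ ψ χ
            have hv := hS.1.1
            simp only [vars, Set.union_subset_iff] at hv
            have := ih' (S' := φ ::ₘ ψ.imp χ ::ₘ S) (ψ' := ψ)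
              (by simpa using Ent.imp_imp (Γ := Γ + S) (by simpa using hd.ent))
              (by simp only [over_cons, vars, Set.union_subset_iff]; tauto) hv.2
              (by simp only [ctxSize_cons]; omega)
            rw [Multiset.cons_swap]
            refine Ent.imp_imp_symm (this.of_forces fun M w hw => ?_)
            simp only [CKModel.forces_cons] at hw ⊢
            tauto
          · push Not at himp
            exact he.ent hS' hS.1.1 (by rintro φ ψ rfl; exact hsα)
              (by rintro φ ψ rfl; exact hsα) himp hd
        have hχ := ih' (S' := χ ::ₘ S) (ψ' := ψ)
          (by simpa using Ent.fire (Γ := Γ + S) (by simpa using h))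
          (over_cons.2 ⟨hS.1.2, hS.2⟩) hψ (by simp only [ctxSize_cons]; omega)
        rw [Multiset.cons_swap] at hα hχ ⊢
        exact Ent.unfire hα hχ
  · have hlt₁ := hsp.lt₁
    have hlt₂ := hsp.lt₂
    have hΓS : ∀ {S'}, (∀ (M : CKModel) (w : M.W), M.forces S' w → M.forces S w) →
        Ent (Γ + S') ψ := fun hh => h.of_forces fun M w hw => by
      rw [CKModel.forces_add] at hw ⊢
      exact ⟨hw.1, hh M w hw.2⟩
    intro M w hw
    rw [CKModel.forces_cons] at hw
    rcases (hsp.forces M w).1 hw.2 with hw' | hw'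
    · exact ih' (hΓS fun M w hw => (hsp.forces M w).2 (.inl hw)) (hsp.vars_sub _ hS).1 hψ
        (by omega) M w (CKModel.forces_cons.2 ⟨hw.1, hw'⟩)
    · exact ih' (hΓS fun M w hw => (hsp.forces M w).2 (.inr hw)) (hsp.vars_sub _ hS).2 hψ
        (by omega) M w (CKModel.forces_cons.2 ⟨hw.1, hw'⟩)

theorem exists_isExists {Γ : Multiset Form} (hΓ : Over (insert p V) Γ)
    (ihE : ∀ Δ, Over (insert p V) Δ → ctxSize Δ < ctxSize Γ → ∃ e, IsExists p V Δ e)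
    (ihA : ∀ Δ δ, Over (insert p V) Δ → vars δ ⊆ insert p V →
      ctxSize Δ + δ.size < ctxSize Γ → ∃ a, IsForall p V Δ δ a) :
    ∃ e, IsExists p V Γ e := by
  rcases exists_splits Γ with hb | hs | ⟨Γ₁, Γ₂, hsp⟩
  · exact ⟨.bot, by simp [vars], Ent.bot_elim hb _,
      fun S ψ _ _ _ => Ent.bot_elim (Multiset.mem_cons_self _ _) _⟩
  · rcases Γ.empty_or_exists_mem with rfl | ⟨θ₀, hθ₀⟩
    · refine ⟨Form.bot.imp .bot, by simp [vars], fun M w _ v _ h => h, fun S ψ _ _ h => ?_⟩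
      exact h.of_forces fun M w hw => by simpa using (CKModel.forces_cons.1 hw).2
    have hbox : ctxSize (boxInv Γ) < ctxSize Γ := by
      obtain ⟨Δ, rfl⟩ := Multiset.exists_cons_of_mem hθ₀
      exact ctxSize_boxInv_cons_lt _ _
    obtain ⟨b, hb⟩ := ihE _ hΓ.boxInv hbox
    have hf : ∀ θ, ∃ g, θ ∈ Γ → vars g ⊆ V ∧ Ent Γ g ∧
        (∀ n, θ = .var n → n ≠ p → g = .var n) ∧
        (∀ γ, θ = .dia γ → ∃ e, IsExists p V (γ ::ₘ boxInv Γ) e ∧ g = e.dia) ∧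
        (∀ α χ, θ = .imp α χ → FiringClause p Γ g α) := by
      intro θ
      by_cases hθ : θ ∈ Γ
      swap
      · exact ⟨.bot, fun h => (hθ h).elim⟩
      have htop : vars (Form.bot.imp .bot) ⊆ V ∧ Ent Γ (Form.bot.imp .bot) :=
        ⟨by simp [vars], fun M w _ v _ h => h⟩
      cases θ with
      | var n =>
        by_cases hn : n = p
        · exact ⟨_, fun _ => ⟨htop.1, htop.2, by simp [hn], by simp, by simp⟩⟩
        · refine ⟨.var n, fun _ => ⟨?_, fun M w hw => hw _ hθ, by simp, by simp, by simp⟩⟩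
          simpa [vars, hn] using hΓ _ hθ
      | dia γ =>
        obtain ⟨e, he⟩ := ihE (γ ::ₘ boxInv Γ) (over_cons.2 ⟨hΓ γ.dia hθ, hΓ.boxInv⟩)
          (ctxSize_dia_boxInv_lt hθ)
        refine ⟨e.dia, fun _ => ⟨he.vars_sub, ?_, by simp, ?_, by simp⟩⟩
        · exact Dir.ent (α := e.dia) ⟨γ, hθ, he.ent⟩
        · rintro γ' ⟨⟩
          exact ⟨e, he, rfl⟩
      | imp α χ =>
        obtain ⟨Δ, rfl⟩ := Multiset.exists_cons_of_mem hθ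
        obtain ⟨c, hc, hcα, hcS⟩ := exists_firing_condition hΓ (hs _ hθ) ihA
        have h₁ := size_imp_right α χ
        have h₂ := χ.size_pos
        have hΓ' := hΓ
        simp only [over_cons, vars, Set.union_subset_iff] at hΓ'
        obtain ⟨e, he⟩ := ihE (χ ::ₘ Δ) (over_cons.2 ⟨hΓ'.1.2, hΓ'.2⟩)
          (by simp only [ctxSize_cons]; omega)
        refine ⟨c.imp e, fun _ => ⟨Set.union_subset hc he.vars_sub, ?_, by simp, by simp, ?_⟩⟩
        · rw [Multiset.cons_swap] at hcα
          refine Ent.imp_elim ?_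
          rw [Multiset.cons_swap]
          refine Ent.unfire hcα (he.ent.of_forces fun M w hw => ?_)
          simp only [CKModel.forces_cons] at hw ⊢
          tauto
        · rintro α' χ' ⟨⟩ S ψ hS hψ h hd M w hw
          rw [CKModel.forces_cons] at hw
          have h' : Ent (χ ::ₘ Δ + S) ψ := by
            rw [Multiset.cons_add] at h ⊢
            exact h.fire
          refine he.uniform S ψ hS hψ h' M w (CKModel.forces_cons.2 ⟨?_, hw.2⟩)
          exact hw.1 w (M.le_refl w) (hcS S hS hd M w hw.2)
      | _ => exact ⟨_, fun _ => ⟨htop.1, htop.2, by simp, by simp, by simp⟩⟩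
    choose f hf using hf
    obtain ⟨d, hd, hdf⟩ := exists_conj Γ f fun θ hθ => (hf θ hθ).1
    have hsub : ∀ θ ∈ Γ, Ent {b.box.and d} (f θ) := fun θ hθ M w hw =>
      (hdf M w).1 (hw _ (Multiset.mem_singleton_self _)).2 θ hθ
    refine ⟨b.box.and d, isExists_of_clauses hs (Set.union_subset hb.vars_sub hd) ?_ ?_ ?_⟩
    · exact fun M w hw => ⟨Dir.ent (α := b.box) hb.ent M w hw,
        (hdf M w).2 fun θ hθ => (hf θ hθ).2.1 M w hw⟩
    · refine ⟨fun n hn hp => ?_, ⟨b, hb, ?_⟩, fun γ hγ => ?_⟩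
      · rw [← (hf _ hn).2.2.1 n rfl hp]
        exact hsub _ hn
      · exact fun M w hw => (hw _ (Multiset.mem_singleton_self _)).1
      · obtain ⟨e, he, hfe⟩ := (hf _ hγ).2.2.2.1 γ rfl
        exact ⟨e, he, hfe ▸ hsub _ hγ⟩
    · intro α χ hm S ψ hS hψ h hd'
      refine ((hf _ hm).2.2.2.2 α χ rfl S ψ hS hψ h hd').of_forces fun M w hw => ?_
      rw [CKModel.forces_cons] at hw ⊢
      exact ⟨(hdf M w).1 hw.1.2 _ hm, hw.2⟩
  · obtain ⟨h₁, h₂⟩ := hsp.vars_sub _ hΓ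
    exact exists_isExists_of_or hsp.forces (ihE _ h₁ hsp.lt₁) (ihE _ h₂ hsp.lt₂)

theorem ent_of_conditions {Γ : Multiset Form} {δ e a : Form} (hs : ∀ φ ∈ Γ, Simple φ)
    (he : IsExists p V Γ e) (hr : ∀ S, Over {p}ᶜ S → Dir (Γ + S) δ → Ent S a)
    (hf : ∀ α χ, Form.imp α χ ∈ Γ → ∀ S, Over {p}ᶜ S → Ent (Γ + S) δ → Dir (Γ + S) α → Ent S a)
    {S : Multiset Form} (hS : Over {p}ᶜ S) (h : Ent (Γ + S) δ) : Ent (e ::ₘ S) a := by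
  induction hn : ctxSize S using Nat.strong_induction_on generalizing S with
  | _ n ih =>
  subst hn
  have weaken : Ent S a → Ent (e ::ₘ S) a :=
    fun h => h.of_forces fun M w hw => (CKModel.forces_cons.1 hw).2
  rcases exists_splits S with hb | hsS | ⟨S₁, S₂, hsp⟩
  · exact Ent.bot_elim (Multiset.mem_cons_of_mem hb) _
  · have hs' : ∀ φ ∈ Γ + S, Simple φ :=
      fun φ hφ => (Multiset.mem_add.1 hφ).elim (hs φ) (hsS φ)
    rcases Dir.of_simple hs' h with hd | ⟨α, χ, hm, hd⟩
    · exact weaken (hr S hS hd)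
    · rcases Multiset.mem_add.1 hm with hm | hm
      · exact weaken (hf α χ hm S hS h hd)
      · obtain ⟨S, rfl⟩ := Multiset.exists_cons_of_mem hm
        have h₁ := size_imp_right α χ
        have h₂ := χ.size_pos
        have hS' := hS
        simp only [over_cons, vars, Set.union_subset_iff] at hS
        have hα := he.uniform _ α hS' hS.1.1 hd.ent
        have hχ := ih _ (by simp only [ctxSize_cons]; omega) (S := χ ::ₘ S)
          (over_cons.2 ⟨hS.1.2, hS.2⟩)
          (by simpa using Ent.fire (Γ := Γ + S) (by simpa using h)) rfl
        rw [Multiset.cons_swap] at hα hχ ⊢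
        exact Ent.unfire hα hχ
  · have hΓS : ∀ {S'}, (∀ (M : CKModel) (w : M.W), M.forces S' w → M.forces S w) →
        Ent (Γ + S') δ := fun hh => h.of_forces fun M w hw => by
      rw [CKModel.forces_add] at hw ⊢
      exact ⟨hw.1, hh M w hw.2⟩
    intro M w hw
    rw [CKModel.forces_cons] at hw
    rcases (hsp.forces M w).1 hw.2 with hw' | hw'
    · exact ih _ hsp.lt₁ (hsp.vars_sub _ hS).1
        (hΓS fun M w hw => (hsp.forces M w).2 (.inl hw)) rfl M w
        (CKModel.forces_cons.2 ⟨hw.1, hw'⟩)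
    · exact ih _ hsp.lt₂ (hsp.vars_sub _ hS).2
        (hΓS fun M w hw => (hsp.forces M w).2 (.inr hw)) rfl M w
        (CKModel.forces_cons.2 ⟨hw.1, hw'⟩)

theorem exists_isForall_of_simple {Γ : Multiset Form} {δ : Form} (hs : ∀ φ ∈ Γ, Simple φ)
    (hΓ : Over (insert p V) Γ) (hδ : vars δ ⊆ insert p V) (hE : ∃ e, IsExists p V Γ e)
    (ih : ∀ Δ θ, Over (insert p V) Δ → vars θ ⊆ insert p V →
      ctxSize Δ + θ.size < ctxSize Γ + δ.size → ∃ a, IsForall p V Δ θ a)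
    (hr : ∃ d, vars d ⊆ V ∧ Ent (d ::ₘ Γ) δ ∧
      ∀ S, Over {p}ᶜ S → Dir (Γ + S) δ → Ent S d) :
    ∃ a, IsForall p V Γ δ a := by
  obtain ⟨e, he⟩ := hE
  obtain ⟨d, hd, hdδ, hdS⟩ := hr
  have hf : ∀ θ, ∃ g, θ ∈ Γ → vars g ⊆ V ∧ Ent (g ::ₘ Γ) δ ∧
      ∀ α χ, θ = .imp α χ → ∀ S, Over {p}ᶜ S → Ent (Γ + S) δ → Dir (Γ + S) α → Ent S g := by
    intro θ
    by_cases hθ : θ ∈ Γ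
    swap
    · exact ⟨.bot, fun h => (hθ h).elim⟩
    by_cases himp : ∃ α χ, θ = .imp α χ
    · obtain ⟨α, χ, rfl⟩ := himp
      obtain ⟨Δ, rfl⟩ := Multiset.exists_cons_of_mem hθ
      have h₁ := size_imp_right α χ
      have h₂ := χ.size_pos
      have h₃ := δ.size_pos
      obtain ⟨c, hc, hcα, hcS⟩ := exists_firing_condition hΓ (hs _ hθ)
        fun Δ' θ h h' hlt => ih Δ' θ h h' (by omega)
      have hΓ' := hΓ
      simp only [over_cons, vars, Set.union_subset_iff] at hΓ'
      obtain ⟨a, ha⟩ := ih (χ ::ₘ Δ) δ (over_cons.2 ⟨hΓ'.1.2, hΓ'.2⟩) hδ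
        (by simp only [ctxSize_cons]; omega)
      refine ⟨c.and a, fun _ => ⟨Set.union_subset hc ha.vars_sub, ?_, ?_⟩⟩
      · intro M w hw
        rw [CKModel.forces_cons] at hw
        have hα := hcα M w (CKModel.forces_cons.2 ⟨hw.1.1, hw.2⟩)
        exact ha.ent M w (CKModel.forces_cons.2 ⟨hw.1.2, (forces_fire hα).1 hw.2⟩)
      · rintro α' χ' ⟨⟩ S hS h hd M w hw
        refine ⟨hcS S hS hd M w hw, ha.uniform S hS ?_ M w hw⟩
        rw [Multiset.cons_add] at h ⊢
        exact h.fire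
    · exact ⟨.bot, fun _ => ⟨by simp [vars], Ent.bot_elim (Multiset.mem_cons_self _ _) _,
        fun α χ h => (himp ⟨α, χ, h⟩).elim⟩⟩
  choose f hf using hf
  obtain ⟨g, hg, hgf⟩ := exists_disj Γ f fun θ hθ => (hf θ hθ).1
  refine ⟨e.imp (d.or g), ?_, ?_, ?_⟩
  · exact Set.union_subset he.vars_sub (Set.union_subset hd hg)
  · intro M w hw
    rw [CKModel.forces_cons] at hw
    rcases hw.1 w (M.le_refl w) (he.ent M w hw.2) with h | h
    · exact hdδ M w (CKModel.forces_cons.2 ⟨h, hw.2⟩)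
    · rcases (hgf M w).1 h with h | ⟨θ, hθ, h⟩
      · exact CKModel.force_of_F h
      · exact (hf θ hθ).2.1 M w (CKModel.forces_cons.2 ⟨h, hw.2⟩)
  · refine fun S hS h => Ent.imp_elim (ent_of_conditions hs he ?_ ?_ hS h)
    · exact fun S hS h M w hw => .inl (hdS S hS h M w hw)
    · exact fun α χ hm S hS h h' M w hw =>
        .inr ((hgf M w).2 (.inr ⟨_, hm, (hf _ hm).2.2 α χ rfl S hS h h' M w hw⟩))

theorem exists_isForall {Γ : Multiset Form} {δ : Form} (hΓ : Over (insert p V) Γ)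
    (hδ : vars δ ⊆ insert p V) (hE : ∃ e, IsExists p V Γ e)
    (ih : ∀ Δ θ, Over (insert p V) Δ → vars θ ⊆ insert p V →
      ctxSize Δ + θ.size < ctxSize Γ + δ.size → ∃ a, IsForall p V Δ θ a) :
    ∃ a, IsForall p V Γ δ a := by
  by_cases hand : ∃ φ ψ, δ = .and φ ψ
  · obtain ⟨φ, ψ, rfl⟩ := hand
    have := size_and_left φ ψ
    have := size_and_right φ ψ
    have := (φ.and ψ).size_pos
    simp only [vars, Set.union_subset_iff] at hδ
    obtain ⟨a₁, h₁⟩ := ih Γ φ hΓ hδ.1 (by omega)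
    obtain ⟨a₂, h₂⟩ := ih Γ ψ hΓ hδ.2 (by omega)
    refine ⟨a₁.and a₂, Set.union_subset h₁.vars_sub h₂.vars_sub, ?_, ?_⟩
    · intro M w hw
      rw [CKModel.forces_cons] at hw
      exact ⟨h₁.ent M w (CKModel.forces_cons.2 ⟨hw.1.1, hw.2⟩),
        h₂.ent M w (CKModel.forces_cons.2 ⟨hw.1.2, hw.2⟩)⟩
    · exact fun S hS h M w hw => ⟨h₁.uniform S hS (fun M w hw => (h M w hw).1) M w hw,
        h₂.uniform S hS (fun M w hw => (h M w hw).2) M w hw⟩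
  by_cases himp : ∃ φ ψ, δ = .imp φ ψ
  · obtain ⟨φ, ψ, rfl⟩ := himp
    have := size_imp_left φ ψ
    have := size_imp_right φ ψ
    have := (φ.imp ψ).size_pos
    simp only [vars, Set.union_subset_iff] at hδ
    obtain ⟨a, ha⟩ := ih (φ ::ₘ Γ) ψ (over_cons.2 ⟨hδ.1, hΓ⟩) hδ.2
      (by simp only [ctxSize_cons]; omega)
    refine ⟨a, ha.vars_sub, ?_, fun S hS h => ha.uniform S hS ?_⟩
    · refine Ent.imp_elim ?_
      rw [Multiset.cons_swap]
      exact ha.ent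
    · simpa using h.imp_intro
  rcases exists_splits Γ with hb | hs | ⟨Γ₁, Γ₂, hsp⟩
  · exact ⟨Form.bot.imp .bot, by simp [vars], Ent.bot_elim (Multiset.mem_cons_of_mem hb) _,
      fun S _ _ M w _ v _ h => h⟩
  · refine exists_isForall_of_simple hs hΓ hδ hE ih ?_
    by_cases hor : ∃ φ ψ, δ = .or φ ψ
    · obtain ⟨φ, ψ, rfl⟩ := hor
      have := size_or_left φ ψ
      have := size_or_right φ ψ
      have := (φ.or ψ).size_pos
      simp only [vars, Set.union_subset_iff] at hδ
      obtain ⟨a₁, h₁⟩ := ih Γ φ hΓ hδ.1 (by omega)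
      obtain ⟨a₂, h₂⟩ := ih Γ ψ hΓ hδ.2 (by omega)
      refine ⟨a₁.or a₂, Set.union_subset h₁.vars_sub h₂.vars_sub, ?_, ?_⟩
      · intro M w hw
        rw [CKModel.forces_cons] at hw
        exact hw.1.imp (fun h => h₁.ent M w (CKModel.forces_cons.2 ⟨h, hw.2⟩))
          (fun h => h₂.ent M w (CKModel.forces_cons.2 ⟨h, hw.2⟩))
      · exact fun S hS h M w hw =>
          h.imp (fun h => h₁.uniform S hS h M w hw) (fun h => h₂.uniform S hS h M w hw)
    · push Not at hand himp hor
      exact exists_right_condition hΓ hδ hand hor himp ih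
  · obtain ⟨h₁, h₂⟩ := hsp.vars_sub _ hΓ
    have := hsp.lt₁
    have := hsp.lt₂
    exact exists_isForall_of_or hsp.forces (ih _ _ h₁ hδ (by omega)) (ih _ _ h₂ hδ (by omega))

theorem exists_interpolants (p : ℕ) (V : Set ℕ) (n : ℕ) :
    (∀ Γ, Over (insert p V) Γ → ctxSize Γ = n → ∃ e, IsExists p V Γ e) ∧
    (∀ Γ δ, Over (insert p V) Γ → vars δ ⊆ insert p V → ctxSize Γ + δ.size = n →
      ∃ a, IsForall p V Γ δ a) := by
  induction n using Nat.strong_induction_on with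
  | _ n ih =>
  constructor
  · rintro Γ hΓ rfl
    exact exists_isExists hΓ (fun Δ h hlt => (ih _ hlt).1 Δ h rfl)
      (fun Δ δ h h' hlt => (ih _ hlt).2 Δ δ h h' rfl)
  · rintro Γ δ hΓ hδ rfl
    have := δ.size_pos
    exact exists_isForall hΓ hδ ((ih (ctxSize Γ) (by omega)).1 Γ hΓ rfl)
      (fun Δ δ h h' hlt => (ih _ hlt).2 Δ δ h h' rfl)

end Interpolants

theorem CKH_imp_iff_ent {φ ψ : Form} : CKH ∅ (φ.imp ψ) ↔ Ent {φ} ψ := by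
  refine ⟨fun h => (ent_of_CKH h).imp_intro, fun h => ?_⟩
  simpa [ctxSet] using CKH_of_ent (Γ := 0) (Ent.imp_elim h)

/-- The logic CK has the uniform interpolation property. -/
theorem CK_uniform_interpolation :
    ∀ (φ : Form) (p : ℕ),
      ∃ eφ aφ : Form,
        -- (1) p-freeness
        vars eφ ⊆ vars φ \ {p} ∧ vars aφ ⊆ vars φ \ {p} ∧
        -- (2) implication
        CKH ∅ (φ.imp eφ) ∧ CKH ∅ (aφ.imp φ) ∧
        -- (3) uniformity
        (∀ ψ : Form, p ∉ vars ψ →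
          (CKH ∅ (φ.imp ψ) → CKH ∅ (eφ.imp ψ)) ∧
          (CKH ∅ (ψ.imp φ) → CKH ∅ (ψ.imp aφ))) := by
  intro φ p
  have hφ : vars φ ⊆ insert p (vars φ \ {p}) := by simp
  obtain ⟨e, he⟩ := (exists_interpolants p (vars φ \ {p}) _).1 {φ} (by simp [Over]) rfl
  obtain ⟨a, ha⟩ := (exists_interpolants p (vars φ \ {p}) _).2 0 φ (over_zero _) hφ rfl
  refine ⟨e, a, he.vars_sub, ha.vars_sub, CKH_imp_iff_ent.2 he.ent, CKH_imp_iff_ent.2 ha.ent,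
    fun ψ hψ => ?_⟩
  have hψ' : vars ψ ⊆ {p}ᶜ := by simpa using hψ
  simp only [CKH_imp_iff_ent]
  refine ⟨fun h => he.uniform 0 ψ (over_zero _) hψ' (by simpa using h), fun h => ?_⟩
  exact ha.uniform {ψ} (by simpa [Over] using hψ') (by simpa using h)
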